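/- For every b ∈ Λ(n,κ): (1/p)·dim_K End_{H_{r,p,n}}(v_b H_{r,n}) = dim_K End_{H_{r,n}}(v_b H_{r,n}) = p·dim_K End_{H_{r,p,n}}(v_b H_{r,p,n}). -/

import Mathlib

noncomputable section
namespace HuMathas

open scoped BigOperators
open scoped Classical

/-! ## The Ariki–Koike algebra presentation -/

variable (K : Type) [CommRing K]

/-- The defining relations of the Ariki–Koike algebra `H_{r,n}(Q)` (with `r = p t`),
with generators `T_0, …, T_{n-1}` indexed by `Fin n`. -/
inductive AKRel (q : K) (p : ℕ) {t : ℕ} (Q : Fin t → K) (n : ℕ) :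
    FreeAlgebra K (Fin n) → FreeAlgebra K (Fin n) → Prop
  | cyclo (h0 : 0 < n) :
      AKRel q p Q n
        (((List.finRange t).map (fun k => FreeAlgebra.ι K (⟨0, h0⟩ : Fin n) ^ p - algebraMap K _ (Q k ^ p))).prod) 0
  | braid01 (h1 : 1 < n) :
      AKRel q p Q n
        (FreeAlgebra.ι K (⟨0, by omega⟩ : Fin n) * FreeAlgebra.ι K (⟨1, h1⟩ : Fin n) *
            FreeAlgebra.ι K (⟨0, by omega⟩ : Fin n) * FreeAlgebra.ι K (⟨1, h1⟩ : Fin n))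
        (FreeAlgebra.ι K (⟨1, h1⟩ : Fin n) * FreeAlgebra.ι K (⟨0, by omega⟩ : Fin n) *
            FreeAlgebra.ι K (⟨1, h1⟩ : Fin n) * FreeAlgebra.ι K (⟨0, by omega⟩ : Fin n))
  | quad (i : ℕ) (hi : 1 ≤ i) (hn : i < n) :
      AKRel q p Q n
        ((FreeAlgebra.ι K (⟨i, hn⟩ : Fin n) + 1) *
          (FreeAlgebra.ι K (⟨i, hn⟩ : Fin n) - algebraMap K _ q)) 0
  | braid (i : ℕ) (hi : 1 ≤ i) (hn : i + 1 < n) :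
      AKRel q p Q n
        (FreeAlgebra.ι K (⟨i, by omega⟩ : Fin n) * FreeAlgebra.ι K (⟨i + 1, hn⟩ : Fin n) *
            FreeAlgebra.ι K (⟨i, by omega⟩ : Fin n))
        (FreeAlgebra.ι K (⟨i + 1, hn⟩ : Fin n) * FreeAlgebra.ι K (⟨i, by omega⟩ : Fin n) *
            FreeAlgebra.ι K (⟨i + 1, hn⟩ : Fin n))
  | comm (i j : ℕ) (hij : i + 1 < j) (hj : j < n) :
      AKRel q p Q n
        (FreeAlgebra.ι K (⟨i, by omega⟩ : Fin n) * FreeAlgebra.ι K (⟨j, hj⟩ : Fin n))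
        (FreeAlgebra.ι K (⟨j, hj⟩ : Fin n) * FreeAlgebra.ι K (⟨i, by omega⟩ : Fin n))

/-- The Ariki–Koike algebra `H_{r,n}(Q)` of type `G(r,1,n)` where `r = p * t`,
presented by generators `T_0, …, T_{n-1}` and the relations `AKRel`. -/
def AK (q : K) (p : ℕ) {t : ℕ} (Q : Fin t → K) (n : ℕ) : Type :=
  RingQuot (AKRel K q p Q n)

instance (q : K) (p : ℕ) {t : ℕ} (Q : Fin t → K) (n : ℕ) : Ring (AK K q p Q n) :=
  inferInstanceAs (Ring (RingQuot (AKRel K q p Q n)))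

instance (q : K) (p : ℕ) {t : ℕ} (Q : Fin t → K) (n : ℕ) : Algebra K (AK K q p Q n) :=
  inferInstanceAs (Algebra K (RingQuot (AKRel K q p Q n)))

section ops
variable (q : K) (p : ℕ) {t : ℕ} (Q : Fin t → K) (n : ℕ)

/-- The generator `T_i` of the Ariki–Koike algebra, for `0 ≤ i ≤ n-1` (and junk value `1`
for `i ≥ n`). -/
def Tg (i : ℕ) : AK K q p Q n :=
  if h : i < n then RingQuot.mkAlgHom K (AKRel K q p Q n) (FreeAlgebra.ι K ⟨i, h⟩) else 1

/-- The Murphy elements `L_k` (`1 ≤ k ≤ n`), defined by `L_1 = T_0` and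
`L_{k+1} = q⁻¹ T_k L_k T_k`;  `L_0` is a junk value. -/
def Lm : ℕ → AK K q p Q n
  | 0 => 1
  | 1 => Tg K q p Q n 0
  | (k + 2) => Ring.inverse q • (Tg K q p Q n (k + 1) * Lm (k + 1) * Tg K q p Q n (k + 1))

/-- The product `T_{i_1} ⋯ T_{i_k}` attached to a word `[i_1, …, i_k]`. -/
def Tword (l : List ℕ) : AK K q p Q n := (l.map (Tg K q p Q n)).prod

/-- The simple transposition `s_i = (i, i+1)` of `{1, …, n} ⊆ ℕ` (junk value `1` unless
`1 ≤ i ≤ n - 1`). -/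
def sswap (i : ℕ) : Equiv.Perm ℕ :=
  if 1 ≤ i ∧ i < n then Equiv.swap i (i + 1) else 1

/-- The permutation of `{1, …, n}` attached to a word in the simple transpositions, where the
letters of the word act in order from left to right (i.e. `s_{i_1}` acts first). -/
def wordPerm (l : List ℕ) : Equiv.Perm ℕ := ((l.map (sswap n)).reverse).prod

/-- `w` is a permutation of `{1, …, n} ⊆ ℕ`, i.e. it fixes everything outside `{1, …, n}`. -/
def IsSnPerm (w : Equiv.Perm ℕ) : Prop := ∀ k : ℕ, (k = 0 ∨ n < k) → w k = k

/-- `l` is a reduced word for `w ∈ S_n` in the simple transpositions `s_1, …, s_{n-1}`. -/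
def IsReducedWordFor (w : Equiv.Perm ℕ) (l : List ℕ) : Prop :=
  (∀ i ∈ l, 1 ≤ i ∧ i < n) ∧ wordPerm n l = w ∧
    ∀ l' : List ℕ, ((∀ i ∈ l', 1 ≤ i ∧ i < n) ∧ wordPerm n l' = w) → l.length ≤ l'.length

/-- The element `T_w` for `w ∈ S_n`, defined via a (choice of) reduced word for `w`; this is
well defined because the braid relations hold in the Ariki–Koike algebra. -/
def Tw (w : Equiv.Perm ℕ) : AK K q p Q n :=
  if h : ∃ l : List ℕ, IsReducedWordFor n w l then Tword K q p Q n (Classical.choose h) else 0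

/-- The element `T_w^* = T_{i_k} ⋯ T_{i_1}`, the image of `T_w` under the anti-automorphism `*`
of the Ariki–Koike algebra which fixes each generator `T_i`. -/
def Twstar (w : Equiv.Perm ℕ) : AK K q p Q n :=
  if h : ∃ l : List ℕ, IsReducedWordFor n w l then
    Tword K q p Q n (Classical.choose h).reverse else 0

/-- The monomial `L_1^{c_1} ⋯ L_n^{c_n}` in the Murphy elements. -/
def Lmono (c : ℕ → ℕ) : AK K q p Q n := (((List.range n).map (fun i => Lm K q p Q n (i + 1) ^ c (i + 1))).prod)

/-- The cyclotomic Hecke algebra `H_{r,p,n}(Q)` of type `G(r,p,n)`: the subalgebra of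
`H_{r,n}(Q)` generated by `T_0^p`, `T_0⁻¹ T_1 T_0` and `T_1, …, T_{n-1}`. -/
def AKp : Subalgebra K (AK K q p Q n) :=
  Algebra.adjoin K
    ({Tg K q p Q n 0 ^ p, Ring.inverse (Tg K q p Q n 0) * Tg K q p Q n 1 * Tg K q p Q n 0} ∪
      {x | ∃ i : ℕ, 1 ≤ i ∧ i < n ∧ x = Tg K q p Q n i})

/-- The automorphism `σ` of `H_{r,n}(Q)` with `σ(T_0) = ε T_0` and `σ(T_i) = T_i` for
`i ≥ 1`; it is the unique algebra automorphism with these values on the generators. -/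
def sigmaAut (ε : K) : AK K q p Q n ≃ₐ[K] AK K q p Q n :=
  if h : ∃ f : AK K q p Q n ≃ₐ[K] AK K q p Q n,
      f (Tg K q p Q n 0) = ε • Tg K q p Q n 0 ∧ ∀ i : ℕ, 1 ≤ i → f (Tg K q p Q n i) = Tg K q p Q n i
  then Classical.choose h else AlgEquiv.refl

/-- The automorphism `τ` of `H_{r,n}(Q)` given by `τ(h) = T_0⁻¹ h T_0` (as a function). -/
def tauMap (x : AK K q p Q n) : AK K q p Q n :=
  Ring.inverse (Tg K q p Q n 0) * x * Tg K q p Q n 0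

end ops

end HuMathas
open scoped Classical
namespace HuMathas

section vb
variable (K : Type) [CommRing K]
variable (q : K) (p : ℕ) {tt : ℕ} (Q : Fin tt → K) (n : ℕ) (κ : ℕ) (t_ : Fin κ → ℕ)

/-- The parameter `Q_k` (1-based indexing, junk value `0` outside `1 ≤ k ≤ t`). -/
def Qat (k : ℕ) : K := if h : 1 ≤ k ∧ k ≤ tt then Q ⟨k - 1, by omega⟩ else 0

/-- `t_α` for `1 ≤ α ≤ κ` (1-based indexing, junk value `0` otherwise). -/
def tat (α : ℕ) : ℕ := if h : 1 ≤ α ∧ α ≤ κ then t_ ⟨α - 1, by omega⟩ else 0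

/-- `t_{1..α} = t_1 + ⋯ + t_α`. -/
def tsum (α : ℕ) : ℕ := ∑ β ∈ Finset.Icc 1 α, tat κ t_ β

/-- The sub-tuple `Q_α = (Q_{t_{1..α-1}+1}, …, Q_{t_{1..α}})` of `Q`. -/
def Qsub (α : ℕ) : Fin (tat κ t_ α) → K :=
  fun i => Qat K Q (tsum κ t_ (α - 1) + i.val + 1)

/-- `Q_i` and `Q_j` lie in the same `(ε,q)`-orbit only if they lie in the same part
`Q_α` of the partition of `Q` determined by `t_`.  (Here `K` must be a field for `zpow`.) -/
def OrbitPartition {K : Type} [Field K] (ε q : K) {tt : ℕ} (Q : Fin tt → K)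
    (κ : ℕ) (t_ : Fin κ → ℕ) : Prop :=
  (tsum κ t_ κ = tt) ∧
  ∀ α β i j : ℕ, 1 ≤ α → α ≤ κ → 1 ≤ β → β ≤ κ →
    tsum κ t_ (α - 1) < i → i ≤ tsum κ t_ α →
    tsum κ t_ (β - 1) < j → j ≤ tsum κ t_ β →
    (∃ a b : ℤ, Qat K Q i = ε ^ a * q ^ b * Qat K Q j) → α = β

variable (b : Fin κ → ℕ)

/-- `b_α` for `1 ≤ α ≤ κ` (1-based indexing, junk value `0` otherwise). -/
def bat (α : ℕ) : ℕ := if h : 1 ≤ α ∧ α ≤ κ then b ⟨α - 1, by omega⟩ else 0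

/-- `b_{1..α} = b_1 + ⋯ + b_α`. -/
def bsum (α : ℕ) : ℕ := ∑ β ∈ Finset.Icc 1 α, bat κ b β

/-- `b_{α..κ} = b_α + ⋯ + b_κ`. -/
def bsumFrom (α : ℕ) : ℕ := ∑ β ∈ Finset.Icc α κ, bat κ b β

/-- `b` is a composition of `n` into `κ` non-negative parts, i.e. `b ∈ Λ(n,κ)`. -/
def IsComp : Prop := bsum κ b κ = n

/-- The word `(s_{a+b-1} ⋯ s_1)^b` representing the permutation `w_{a,b}`. -/
def wabWord (a c : ℕ) : List ℕ :=
  (List.replicate c ((List.range' 1 (a + c - 1)).reverse)).flatten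

/-- The permutation `w_{a,b} = (s_{a+b-1} ⋯ s_1)^b` of `{1, …, n}`. -/
def wabPerm (a c : ℕ) : Equiv.Perm ℕ := wordPerm n (wabWord a c)

/-- `v^+_{a,b}(s) = ∏_{k=1}^{s} (L_1^p - Q_k^p) ⋯ (L_a^p - Q_k^p) · T_{w_{a,b}}`. -/
def vplus (a c s : ℕ) : AK K q p Q n :=
  (((List.range s).map (fun k0 =>
      ((List.range a).map (fun m0 =>
        Lm K q p Q n (m0 + 1) ^ p - algebraMap K _ (Qat K Q (k0 + 1) ^ p))).prod)).prod) *
    Tword K q p Q n (wabWord a c)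

/-- `u^+_{ω_b} = ∏_{α=1}^{κ-1} ∏_{k=t_{1..α}+1}^{t_{1..α+1}} (L_1^p - Q_k^p) ⋯ (L_{b_{1..α}}^p - Q_k^p)`. -/
def uplusOmega : AK K q p Q n :=
  (((List.range (κ - 1)).map (fun α0 =>
      ((List.range (tsum κ t_ (α0 + 2) - tsum κ t_ (α0 + 1))).map (fun k0 =>
        ((List.range (bsum κ b (α0 + 1))).map (fun m0 =>
          Lm K q p Q n (m0 + 1) ^ p -
            algebraMap K _ (Qat K Q (tsum κ t_ (α0 + 1) + k0 + 1) ^ p))).prod)).prod)).prod)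

/-- `v_b^- = ∏_{α=κ}^{2} ∏_{i=1}^{t_{1..α-1}} (L_1^p - Q_i^p) ⋯ (L_{b_α}^p - Q_i^p) ·
T_{w_{b_α, b_{1..α-1}}}`, with `α` decreasing from left to right. -/
def vbMinus : AK K q p Q n :=
  ((List.range (κ - 1)).map (fun idx =>
    vplus K q p Q n (bat κ b (κ - idx)) (bsum κ b (κ - idx - 1)) (tsum κ t_ (κ - idx - 1)))).prod

/-- The element `v_b = v^+_{b_κ, b_{1..κ-1}}(t_{1..κ-1}) ⋯ v^+_{b_2, b_1}(t_1) · u^+_{ω_b}`. -/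
def vb : AK K q p Q n :=
  vbMinus K q p Q n κ t_ b * uplusOmega K q p Q n κ t_ b

/-- The permutation `w_b = w_{b_κ, b_{1..κ-1}} w_{b_{κ-1}, b_{1..κ-2}} ⋯ w_{b_2, b_1}`. -/
def wbPerm : Equiv.Perm ℕ :=
  wordPerm n (((List.range (κ - 1)).map (fun idx =>
    wabWord (bat κ b (κ - idx)) (bsum κ b (κ - idx - 1)))).flatten)

/-- The right ideal `a · H` of `H = H_{r,n}(Q)`, as a submodule for the right regular action
(i.e. as a module over the opposite ring). -/
def rIdeal (a : AK K q p Q n) : Submodule (AK K q p Q n)ᵐᵒᵖ (AK K q p Q n) where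
  carrier := {x | ∃ h : AK K q p Q n, x = a * h}
  add_mem' := by
    rintro x y ⟨h1, rfl⟩ ⟨h2, rfl⟩
    exact ⟨h1 + h2, by rw [mul_add]⟩
  zero_mem' := ⟨0, by rw [mul_zero]⟩
  smul_mem' := by
    rintro c x ⟨h, rfl⟩
    refine ⟨h * c.unop, ?_⟩
    rw [← MulOpposite.op_unop c, op_smul_eq_mul, MulOpposite.unop_op, mul_assoc]

/-- The subspace `v · H_{r,p,n}(Q)` of `H_{r,n}(Q)`, as a `K`-submodule. -/
def vSubmoduleP (v : AK K q p Q n) : Submodule K (AK K q p Q n) :=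
  Submodule.map (LinearMap.mulLeft K v) (Subalgebra.toSubmodule (AKp K q p Q n))

/-- The subspace `v · H_{r,n}(Q)` of `H_{r,n}(Q)`, as a `K`-submodule. -/
def vSubmodule (v : AK K q p Q n) : Submodule K (AK K q p Q n) :=
  LinearMap.range (LinearMap.mulLeft K v)

end vb
end HuMathas

namespace HuMathas
section blockProd
variable (K : Type) [CommRing K] (q : K) (p : ℕ) {tt : ℕ} (Q : Fin tt → K) (n : ℕ)
variable (κ : ℕ) (t_ : Fin κ → ℕ)

/-- The product `∏_{Q_i ∈ Q_α} (L_m^p - Q_i^p)` over the `α`-th part of the partition of `Q`. -/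
def LQblockProd (m α : ℕ) : AK K q p Q n :=
  ((List.range (tat κ t_ α)).map (fun i0 =>
    Lm K q p Q n m ^ p -
      algebraMap K _ (Qat K Q (tsum κ t_ (α - 1) + i0 + 1) ^ p))).prod

end blockProd
end HuMathas
namespace HuMathas

section genmod

/-- The type of linear maps between two modules with explicitly given module structures
(used to talk about restricted module structures without instance problems). -/
abbrev RLinMap (R : Type) [Ring R] (M N : Type) [AddCommGroup M] [AddCommGroup N]
    (mM : Module R M) (mN : Module R N) : Type :=
  @LinearMap R R _ _ (RingHom.id R) M N _ _ mM mN

/-- The type of linear equivalences between two modules with explicitly given module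
structures. -/
abbrev RLinEquiv (R : Type) [Ring R] (M N : Type) [AddCommGroup M] [AddCommGroup N]
    (mM : Module R M) (mN : Module R N) : Type :=
  @LinearEquiv R R _ _ (RingHom.id R) (RingHom.id R) RingHomInvPair.ids RingHomInvPair.ids
    M N _ _ mM mN

/-- `N` (a right `B`-module, given as a left module over `Bᵐᵒᵖ`) is the module induced from the
right `B'`-module `M` along the ring homomorphism `ι : B' →+* B`, i.e. `N ≅ M ⊗_{B'} B`;
this is expressed by the universal property of induction (Frobenius reciprocity):  there is a
`B'`-linear map `u : M → N↓` such that every `B'`-linear map from `M` to the restriction of a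
right `B`-module `P` factors uniquely through a `B`-linear map `N → P`. -/
def IsInducedFrom (B' B : Type) [Ring B'] [Ring B] (ι : B' →+* B)
    (M : Type) [AddCommGroup M] (mM : Module B'ᵐᵒᵖ M)
    (N : Type) [AddCommGroup N] (mN : Module Bᵐᵒᵖ N) : Prop :=
  letI := mN
  ∃ u : RLinMap B'ᵐᵒᵖ M N mM (Module.compHom N (RingHom.op ι)),
    ∀ (P : Type) (_ : AddCommGroup P) (mP : Module Bᵐᵒᵖ P),
      ∀ f : RLinMap B'ᵐᵒᵖ M P mM (letI := mP; Module.compHom P (RingHom.op ι)),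
        ∃! g : @LinearMap Bᵐᵒᵖ Bᵐᵒᵖ _ _ (RingHom.id Bᵐᵒᵖ) N P _ _ mN mP,
          ∀ m : M, g (u m) = f m

end genmod

end HuMathas
open scoped Classical
namespace HuMathas



section rmodAK
variable (K : Type) [CommRing K] (q : K) (p : ℕ) {tt : ℕ} (Q : Fin tt → K) (n : ℕ)

/-- The opposite of the inclusion `H_{r,p,n}(Q) ⊆ H_{r,n}(Q)`; restriction along this map
realizes a right `H_{r,n}`-module as a right `H_{r,p,n}`-module. -/
def inclOp : (↥(AKp K q p Q n))ᵐᵒᵖ →+* (AK K q p Q n)ᵐᵒᵖ :=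
  RingHom.op ((AKp K q p Q n).val.toRingHom)

/-- `H_{r,n}(Q)` as a right `H_{r,p,n}(Q)`-module. -/
instance AKpOpModule : Module (↥(AKp K q p Q n))ᵐᵒᵖ (AK K q p Q n) :=
  Module.compHom _ (inclOp K q p Q n)

/-- The right `H_{r,p,n}`-submodule `v · H_{r,p,n}` of `H_{r,n}`. -/
def rIdealP (v : AK K q p Q n) :
    Submodule (↥(AKp K q p Q n))ᵐᵒᵖ (AK K q p Q n) where
  carrier := {x | ∃ h ∈ AKp K q p Q n, x = v * h}
  add_mem' := by
    rintro x y ⟨h1, hm1, rfl⟩ ⟨h2, hm2, rfl⟩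
    exact ⟨h1 + h2, add_mem hm1 hm2, by rw [mul_add]⟩
  zero_mem' := ⟨0, zero_mem _, by rw [mul_zero]⟩
  smul_mem' := by
    rintro c x ⟨h, hm, rfl⟩
    refine ⟨h * (c.unop : AK K q p Q n), mul_mem hm c.unop.2, ?_⟩
    show (inclOp K q p Q n c) • (v * h) = _
    rw [← MulOpposite.op_unop (inclOp K q p Q n c), op_smul_eq_mul]
    simp [inclOp, mul_assoc]

end rmodAK
end HuMathas

namespace HuMathas
section endspace
variable (K : Type) [CommRing K] (q : K) (p : ℕ) {tt : ℕ} (Q : Fin tt → K) (n : ℕ)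

/-- For a `K`-subspace `V` of `H_{r,n}(Q)` which is stable under right multiplication by the
elements `h` satisfying `P h`, the space of `K`-linear endomorphisms of `V` commuting with all
right multiplications by such `h`.  Taking `P = ⊤` (resp. `P = (· ∈ H_{r,p,n})`) this is the
endomorphism algebra of `V` as a right `H_{r,n}`- (resp. `H_{r,p,n}`-) module, viewed as a
`K`-vector space. -/
def EndSpace (V : Submodule K (AK K q p Q n)) (P : AK K q p Q n → Prop) :
    Submodule K (↥V →ₗ[K] ↥V) where
  carrier := {f | ∀ (x y : ↥V) (h : AK K q p Q n), P h →
    (y : AK K q p Q n) = (x : AK K q p Q n) * h →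
      ((f y : AK K q p Q n)) = (f x : AK K q p Q n) * h}
  add_mem' := by
    intro f g hf hg x y h hP hxy
    simp only [LinearMap.add_apply, Submodule.coe_add,
      hf x y h hP hxy, hg x y h hP hxy, add_mul]
  zero_mem' := by
    intro x y h hP hxy
    simp [zero_mul]
  smul_mem' := by
    intro c f hf x y h hP hxy
    simp only [LinearMap.smul_apply, Submodule.coe_smul,
      hf x y h hP hxy, smul_mul_assoc]

end endspace
end HuMathas

namespace HuMathas
section homspace
variable (K : Type) [CommRing K] (q : K) (p : ℕ) {tt : ℕ} (Q : Fin tt → K) (n : ℕ)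

/-- For `K`-subspaces `V, W` of `H_{r,n}(Q)`, the space of `K`-linear maps `V → W` commuting
with right multiplication by all elements `h` with `P h`. -/
def HomSpace (V W : Submodule K (AK K q p Q n)) (P : AK K q p Q n → Prop) :
    Submodule K (↥V →ₗ[K] ↥W) where
  carrier := {f | ∀ (x y : ↥V) (h : AK K q p Q n), P h →
    (y : AK K q p Q n) = (x : AK K q p Q n) * h →
      ((f y : AK K q p Q n)) = (f x : AK K q p Q n) * h}
  add_mem' := by
    intro f g hf hg x y h hP hxy
    simp only [LinearMap.add_apply, Submodule.coe_add,
      hf x y h hP hxy, hg x y h hP hxy, add_mul]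
  zero_mem' := by
    intro x y h hP hxy
    simp [zero_mul]
  smul_mem' := by
    intro c f hf x y h hP hxy
    simp only [LinearMap.smul_apply, Submodule.coe_smul,
      hf x y h hP hxy, smul_mul_assoc]

end homspace

section progen

/-- A progenerator: a projective module containing every projective indecomposable module as
a direct summand. -/
def IsProgenerator (B V : Type) [Ring B] [AddCommGroup V] [Module B V] : Prop :=
  Module.Projective B V ∧
  ∀ (P : Type) (_ : AddCommGroup P) (mP : Module B P),
    (letI := mP; Module.Projective B P) →
    (letI := mP; (⊥ : Submodule B P) ≠ ⊤) →
    (letI := mP; ∀ X Y : Submodule B P, X ⊓ Y = ⊥ → X ⊔ Y = ⊤ → X = ⊥ ∨ Y = ⊥) →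
    (letI := mP; ∃ (inj : P →ₗ[B] V) (proj : V →ₗ[B] P), ∀ x, proj (inj x) = x)

end progen
end HuMathas

namespace HuMathas

/-- The projection onto the `ε ^ j`-eigenspace of an operator `Φ` with `Φ ^ p = 1`. -/
def eigenProj {K E : Type} [Field K] [AddCommMonoid E] [Module K E] (p : ℕ) (ε : K)
    (Φ : Module.End K E) (j : ℕ) : Module.End K E :=
  (p : K)⁻¹ • ∑ i ∈ Finset.range p, ((ε ^ j)⁻¹) ^ i • Φ ^ i

section eigenProj
variable {K E : Type} [Field K] [AddCommMonoid E] [Module K E] {p : ℕ} {ε : K}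

theorem sum_root_pow_eq_ite (hp : 0 < p) (hε : IsPrimitiveRoot ε p) {j k : ℕ} (hj : j < p)
    (hk : k < p) :
    ∑ i ∈ Finset.range p, ((ε ^ j)⁻¹ * ε ^ k) ^ i = if j = k then (p : K) else 0 := by
  have hε0 : ε ≠ 0 := hε.ne_zero hp.ne'
  split_ifs with h
  · subst h
    rw [inv_mul_cancel₀ (pow_ne_zero _ hε0)]
    simp
  · have h1 : ((ε ^ j)⁻¹ * ε ^ k) ≠ 1 := by
      intro h1
      have : ε ^ k = ε ^ j := by
        field_simp at h1
        exact h1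
      exact h (hε.pow_inj hk hj this).symm
    have h2 : ((ε ^ j)⁻¹ * ε ^ k) ^ p = 1 := by
      rw [mul_pow, inv_pow, ← pow_mul, ← pow_mul, mul_comm j, mul_comm k, pow_mul, pow_mul,
        hε.pow_eq_one]
      simp
    have h3 := mul_geom_sum ((ε ^ j)⁻¹ * ε ^ k) p
    rw [h2, sub_self] at h3
    exact (mul_eq_zero.mp h3).resolve_left (sub_ne_zero.mpr h1)

theorem commute_eigenProj {X Φ : Module.End K E} (h : Commute X Φ) (j : ℕ) :
    Commute X (eigenProj p ε Φ j) :=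
  Commute.smul_right (Commute.sum_right _ _ _ fun _ _ => (h.pow_right _).smul_right _) _

theorem mul_eigenProj (hp : 0 < p) (hε : IsPrimitiveRoot ε p) {Φ : Module.End K E}
    (hΦ : Φ ^ p = 1) (j : ℕ) : Φ * eigenProj p ε Φ j = ε ^ j • eigenProj p ε Φ j := by
  have hε0 : ε ≠ 0 := hε.ne_zero hp.ne'
  simp only [eigenProj]
  rw [mul_smul_comm, smul_comm (ε ^ j)]
  congr 1
  have e1 : Φ * ∑ i ∈ Finset.range p, ((ε ^ j)⁻¹) ^ i • Φ ^ i =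
      ε ^ j • ∑ i ∈ Finset.range p, ((ε ^ j)⁻¹) ^ (i + 1) • Φ ^ (i + 1) := by
    rw [Finset.mul_sum, Finset.smul_sum]
    refine Finset.sum_congr rfl fun i _ => ?_
    rw [mul_smul_comm, smul_smul, ← pow_succ', pow_succ' (ε ^ j)⁻¹, ← mul_assoc,
      mul_inv_cancel₀ (pow_ne_zero _ hε0), one_mul]
  rw [e1]
  congr 1
  have e2 : ((ε ^ j)⁻¹) ^ p = 1 := by
    rw [inv_pow, ← pow_mul, mul_comm, pow_mul, hε.pow_eq_one]; simp
  obtain ⟨k, rfl⟩ : ∃ k, p = k + 1 := ⟨p - 1, by omega⟩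
  conv_lhs => rw [Finset.sum_range_succ, e2, hΦ]
  conv_rhs => rw [Finset.sum_range_succ']
  simp

theorem eigenProj_apply_of_eq (hp : 0 < p) (hε : IsPrimitiveRoot ε p) {Φ : Module.End K E}
    {j k : ℕ} (hj : j < p) (hk : k < p) {x : E} (hx : Φ x = ε ^ k • x) :
    eigenProj p ε Φ j x = if j = k then x else 0 := by
  have : NeZero p := ⟨hp.ne'⟩
  have hpK : (p : K) ≠ 0 := (hε.neZero').out
  have h1 : ∀ i : ℕ, (Φ ^ i) x = (ε ^ k) ^ i • x := by
    intro i
    induction i with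
    | zero => simp
    | succ i ih => rw [pow_succ, Module.End.mul_apply, hx, map_smul, ih, smul_smul, pow_succ']
  simp only [eigenProj, LinearMap.smul_apply, LinearMap.sum_apply, h1, smul_smul, ← mul_pow]
  rw [← Finset.sum_smul, sum_root_pow_eq_ite hp hε hj hk]
  split_ifs
  · rw [smul_smul, inv_mul_cancel₀ hpK, one_smul]
  · simp

theorem sum_eigenProj (hp : 0 < p) (hε : IsPrimitiveRoot ε p) (Φ : Module.End K E) :
    ∑ j ∈ Finset.range p, eigenProj p ε Φ j = 1 := by
  have : NeZero p := ⟨hp.ne'⟩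
  have hpK : (p : K) ≠ 0 := (hε.neZero').out
  simp only [eigenProj]
  rw [← Finset.smul_sum, Finset.sum_comm]
  have : ∀ i ∈ Finset.range p, ∑ j ∈ Finset.range p, ((ε ^ j)⁻¹) ^ i • Φ ^ i =
      if i = 0 then (p : K) • (1 : Module.End K E) else 0 := by
    intro i hi
    rw [← Finset.sum_smul]
    have h1 := sum_root_pow_eq_ite hp hε (Finset.mem_range.1 hi) hp
    have h2 : ∑ j ∈ Finset.range p, ((ε ^ j)⁻¹) ^ i =
        ∑ j ∈ Finset.range p, ((ε ^ i)⁻¹ * ε ^ 0) ^ j := by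
      refine Finset.sum_congr rfl fun j _ => ?_
      rw [pow_zero, mul_one, inv_pow, inv_pow, ← pow_mul, ← pow_mul, mul_comm]
    rw [h2, h1]
    split_ifs with h
    · simp [h]
    · simp
  rw [Finset.sum_congr rfl this]
  simp [hp, smul_smul, inv_mul_cancel₀ hpK]

theorem finrank_fin_fun (K F : Type) [Field K] [AddCommGroup F] [Module K F] (p : ℕ) :
    Module.finrank K (Fin p → F) = p * Module.finrank K F := by
  simp [Module.finrank]

theorem finrank_eq_mul_of_twist (hp : 0 < p) (hε : IsPrimitiveRoot ε p) (Φ S S' : Module.End K E)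
    (hΦ : Φ ^ p = 1) (hS : S * S' = 1) (hS' : S' * S = 1) (hΦS : Φ * S = ε • (S * Φ))
    (F : Submodule K E) (hF : ∀ x, x ∈ F ↔ Φ x = x) :
    Module.finrank K E = p * Module.finrank K F := by
  have hε0 : ε ≠ 0 := hε.ne_zero hp.ne'
  have hΦSk : ∀ k : ℕ, Φ * S ^ k = ε ^ k • (S ^ k * Φ) := by
    intro k
    induction k with
    | zero => simp
    | succ k ih =>
      rw [pow_succ, ← mul_assoc, ih, smul_mul_assoc, mul_assoc, hΦS, mul_smul_comm, smul_smul,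
        mul_assoc, pow_succ]
  have hΦS' : ∀ k : ℕ, Φ * S' ^ k = (ε ^ k)⁻¹ • (S' ^ k * Φ) := by
    have h1 : Φ * S' = ε⁻¹ • (S' * Φ) := by
      have : S' * (Φ * S) * S' = ε • (S' * (S * Φ) * S') := by
        rw [hΦS, mul_smul_comm, smul_mul_assoc]
      rw [← mul_assoc S' S, hS', one_mul, mul_assoc, mul_assoc, hS, mul_one] at this
      rw [this, smul_smul, inv_mul_cancel₀ hε0, one_smul]
    intro k
    induction k with
    | zero => simp
    | succ k ih =>
      rw [pow_succ, ← mul_assoc, ih, smul_mul_assoc, mul_assoc, h1, mul_smul_comm, smul_smul,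
        mul_assoc, pow_succ, mul_inv]
  have hSS : ∀ k, S ^ k * S' ^ k = 1 := fun k => by
    have hc : Commute S S' := hS.trans hS'.symm
    rw [← hc.mul_pow, hS, one_pow]
  have hSS' : ∀ k, S' ^ k * S ^ k = 1 := fun k => by
    have hc : Commute S' S := hS'.trans hS.symm
    rw [← hc.mul_pow, hS', one_pow]
  set P : ℕ → Module.End K E := eigenProj p ε Φ
  have hΦP : ∀ j, Φ * P j = ε ^ j • P j := mul_eigenProj hp hε hΦ
  have hPF : ∀ j x, (S' ^ j * P j) x ∈ F := by
    intro j x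
    rw [hF]
    have : Φ * (S' ^ j * P j) = S' ^ j * P j := by
      rw [← mul_assoc, hΦS', smul_mul_assoc, mul_assoc, hΦP, mul_smul_comm, smul_smul,
        inv_mul_cancel₀ (pow_ne_zero _ hε0), one_smul]
    rw [← Module.End.mul_apply, this]
  have hPS : ∀ j k : ℕ, j < p → k < p → ∀ x ∈ F, P j ((S ^ k) x) =
      if j = k then (S ^ k) x else 0 := by
    intro j k hj hk x hx
    refine eigenProj_apply_of_eq hp hε hj hk ?_
    rw [← Module.End.mul_apply, hΦSk, LinearMap.smul_apply, Module.End.mul_apply, (hF x).1 hx]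
  have hsumP : ∑ j ∈ Finset.range p, P j = 1 := sum_eigenProj hp hε Φ
  let e : E ≃ₗ[K] (Fin p → F) :=
    { toFun := fun x j => ⟨(S' ^ (j : ℕ) * P j) x, hPF j x⟩
      map_add' := fun x y => by ext j; simp
      map_smul' := fun c x => by ext j; simp
      invFun := fun f => ∑ j : Fin p, (S ^ (j : ℕ)) (f j)
      left_inv := fun x => by
        have : ∀ j : Fin p, (S ^ (j : ℕ)) ((S' ^ (j : ℕ) * P j) x) = P j x := by
          intro j
          rw [← Module.End.mul_apply, ← mul_assoc, hSS, one_mul]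
        simp only [this]
        rw [← LinearMap.sum_apply, Fin.sum_univ_eq_sum_range (fun j => P j), hsumP]
        rfl
      right_inv := fun f => by
        ext j
        simp only [Module.End.mul_apply, map_sum]
        have : ∀ k : Fin p, (S' ^ (j : ℕ)) (P j ((S ^ (k : ℕ)) (f k))) =
            if j = k then (f k : E) else 0 := by
          intro k
          rw [hPS j k j.2 k.2 _ (f k).2]
          by_cases h : j = k
          · subst h
            simp [← Module.End.mul_apply, hSS']
          · have : (j : ℕ) ≠ k := fun h' => h (Fin.ext h')
            simp [h, this]
        simp [this] }
  rw [e.finrank_eq]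
  exact @finrank_fin_fun K F _ (Module.addCommMonoidToAddCommGroup K) _ p

end eigenProj

/-- `A` is generated over the subalgebra `B` of fixed points of `σ` by a unit `t` which satisfies
`σ t = ε t` and normalizes `B`, and whose `p`-th power lies in `B`. -/
structure IsCrossed {K A : Type} [Field K] [Ring A] [Algebra K A] (p : ℕ) (ε : K) (σ : A →ₐ[K] A)
    (B : Subalgebra K A) (t : Aˣ) : Prop where
  map_unit : σ t = ε • (t : A)
  map_eq : ∀ b ∈ B, σ b = b
  conj_mem : ∀ b ∈ B, t * b * ((t⁻¹ : Aˣ) : A) ∈ B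
  conj_inv_mem : ∀ b ∈ B, ((t⁻¹ : Aˣ) : A) * b * t ∈ B
  pow_mem : (t : A) ^ p ∈ B
  inv_pow_mem : ((t⁻¹ : Aˣ) : A) ^ p ∈ B
  mem_span : ∀ a, a ∈ Submodule.span K {x | ∃ b ∈ B, ∃ k : ℕ, x = b * (t : A) ^ k}

/-- The elements of `v S` annihilated on the right by all `s ∈ S` with `v s = 0`: the possible
images of `v` under `S`-linear endomorphisms of `v S`. -/
def endImages {K A : Type} [Field K] [Ring A] [Algebra K A] (S : Subalgebra K A) (v : A) :
    Submodule K A where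
  carrier := {w | (∃ s ∈ S, w = v * s) ∧ ∀ s ∈ S, v * s = 0 → w * s = 0}
  add_mem' := by
    rintro _ _ ⟨⟨s, hs, rfl⟩, h1⟩ ⟨⟨s', hs', rfl⟩, h2⟩
    exact ⟨⟨s + s', add_mem hs hs', by rw [mul_add]⟩, fun z hz h => by
      rw [add_mul, h1 z hz h, h2 z hz h, add_zero]⟩
  zero_mem' := ⟨⟨0, zero_mem _, by simp⟩, by simp⟩
  smul_mem' := by
    rintro c _ ⟨⟨s, hs, rfl⟩, h1⟩
    exact ⟨⟨c • s, S.smul_mem hs c, by rw [mul_smul_comm]⟩, fun z hz h => by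
      rw [smul_mul_assoc, h1 z hz h, smul_zero]⟩

section endImages
variable {K A : Type} [Field K] [Ring A] [Algebra K A]

theorem finrank_eq_finrank_endImages (S : Subalgebra K A) (v : A) (V : Submodule K A)
    (hV : ∀ x, x ∈ V ↔ ∃ s ∈ S, x = v * s) (E : Submodule K (V →ₗ[K] V))
    (hE : ∀ f, f ∈ E ↔ ∀ (x y : V) (s : A), s ∈ S → (y : A) = x * s → (f y : A) = f x * s) :
    Module.finrank K E = Module.finrank K (endImages S v) := by
  have hvV : v ∈ V := (hV v).2 ⟨1, one_mem _, by simp⟩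
  have hmem : ∀ f : E, ((f : V →ₗ[K] V) ⟨v, hvV⟩ : A) ∈ endImages S v := by
    intro f
    obtain ⟨s, hs, e⟩ := (hV _).1 ((f : V →ₗ[K] V) ⟨v, hvV⟩).2
    refine ⟨⟨s, hs, e⟩, fun z hz h => ?_⟩
    have := (hE f).1 f.2 ⟨v, hvV⟩ 0 z hz (by simp [h])
    simpa using this.symm
  let ev : E →ₗ[K] endImages S v :=
    { toFun := fun f => ⟨(f : V →ₗ[K] V) ⟨v, hvV⟩, hmem f⟩
      map_add' := fun f g => by ext; simp
      map_smul' := fun c f => by ext; simp }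
  refine (LinearEquiv.ofBijective ev ⟨?_, ?_⟩).finrank_eq
  · intro f g hfg
    have hfg' : ((f : V →ₗ[K] V) ⟨v, hvV⟩ : A) = (g : V →ₗ[K] V) ⟨v, hvV⟩ :=
      congrArg (fun z : endImages S v => (z : A)) hfg
    ext x
    obtain ⟨s, hs, e⟩ := (hV _).1 x.2
    rw [(hE f).1 f.2 ⟨v, hvV⟩ x s hs e, (hE g).1 g.2 ⟨v, hvV⟩ x s hs e, hfg']
  · rintro ⟨w, ⟨s, hs, rfl⟩, hw⟩
    choose c hcS hc using fun x : V => (hV _).1 x.2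
    have key : ∀ (x : V) (r : A), r ∈ S → (x : A) = v * r → v * s * c x = v * s * r := by
      intro x r hr e
      rw [← sub_eq_zero, ← mul_sub]
      exact hw _ (sub_mem (hcS x) hr) (by rw [mul_sub, ← hc, e, sub_self])
    let f : V →ₗ[K] V :=
      { toFun := fun x => ⟨v * s * c x, (hV _).2 ⟨s * c x, mul_mem hs (hcS x), mul_assoc _ _ _⟩⟩
        map_add' := fun x y => by
          ext
          simp only [Submodule.coe_add]
          rw [key (x + y) (c x + c y) (add_mem (hcS x) (hcS y))
            (by rw [mul_add, ← hc, ← hc, Submodule.coe_add]), mul_add]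
        map_smul' := fun a x => by
          ext
          simp only [Submodule.coe_smul, RingHom.id_apply]
          rw [key (a • x) (a • c x) (S.smul_mem (hcS x) a)
            (by rw [mul_smul_comm, ← hc, Submodule.coe_smul]), mul_smul_comm] }
    have hf : f ∈ E := (hE f).2 fun x y r hr e => by
      show v * s * c y = v * s * c x * r
      rw [key y (c x * r) (mul_mem (hcS x) hr) (by rw [e, hc x, mul_assoc]), mul_assoc, mul_assoc,
        mul_assoc]
    refine ⟨⟨f, hf⟩, Subtype.ext ?_⟩
    show v * s * c ⟨v, hvV⟩ = v * s
    rw [key ⟨v, hvV⟩ 1 (one_mem _) (by simp), mul_one]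

end endImages

namespace IsCrossed
variable {K A : Type} [Field K] [Ring A] [Algebra K A] {p : ℕ} {ε : K} {σ : A →ₐ[K] A}
  {B : Subalgebra K A} {t : Aˣ}

theorem map_mul_pow (h : IsCrossed p ε σ B t) {b : A} (hb : b ∈ B) (k : ℕ) :
    σ (b * (t : A) ^ k) = ε ^ k • (b * (t : A) ^ k) := by
  rw [map_mul, h.map_eq b hb, map_pow, h.map_unit, smul_pow, mul_smul_comm]

theorem pow_eq_one (h : IsCrossed p ε σ B t) (hε : ε ^ p = 1) :
    (σ.toLinearMap : Module.End K A) ^ p = 1 := by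
  refine LinearMap.ext fun a => ?_
  have := h.mem_span a
  induction this using Submodule.span_induction with
  | mem x hx =>
    obtain ⟨b, hb, k, rfl⟩ := hx
    have : ∀ i : ℕ, ((σ.toLinearMap : Module.End K A) ^ i) (b * (t : A) ^ k) =
        (ε ^ k) ^ i • (b * (t : A) ^ k) := by
      intro i
      induction i with
      | zero => simp
      | succ i ih =>
        rw [pow_succ', Module.End.mul_apply, ih, map_smul, AlgHom.toLinearMap_apply,
          h.map_mul_pow hb, smul_smul, pow_succ]
    rw [this, ← pow_mul, mul_comm, pow_mul, hε]
    simp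
  | zero => simp
  | add x y _ _ hx hy => rw [map_add, map_add, hx, hy]
  | smul c x _ hx => rw [map_smul, map_smul, hx]

theorem pow_mul_mem (h : IsCrossed p ε σ B t) (k : ℕ) : (t : A) ^ (p * k) ∈ B := by
  rw [pow_mul]
  exact Subalgebra.pow_mem _ h.pow_mem k

theorem eigenProj_zero_mem (h : IsCrossed p ε σ B t) (hp : 0 < p) (hε : IsPrimitiveRoot ε p)
    (a : A) : eigenProj p ε σ.toLinearMap 0 a ∈ B := by
  have := h.mem_span a
  induction this using Submodule.span_induction with
  | mem x hx =>
    obtain ⟨b, hb, k, rfl⟩ := hx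
    have e : ε ^ k = ε ^ (k % p) := by
      conv_lhs => rw [← Nat.mod_add_div k p, pow_add, pow_mul, hε.pow_eq_one, one_pow, mul_one]
    have e1 := h.map_mul_pow hb k
    rw [e] at e1
    rw [eigenProj_apply_of_eq hp hε hp (Nat.mod_lt k hp) e1]
    split_ifs with hk
    · obtain ⟨j, rfl⟩ := Nat.dvd_of_mod_eq_zero hk.symm
      exact mul_mem hb (h.pow_mul_mem j)
    · exact zero_mem _
  | zero => simp
  | add x y _ _ hx hy => rw [map_add]; exact add_mem hx hy
  | smul c x _ hx => rw [map_smul]; exact B.smul_mem hx c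

theorem mem_iff (h : IsCrossed p ε σ B t) (hp : 0 < p) (hε : IsPrimitiveRoot ε p) {a : A} :
    a ∈ B ↔ σ a = a := by
  refine ⟨h.map_eq a, fun ha => ?_⟩
  have := eigenProj_apply_of_eq (Φ := σ.toLinearMap) hp hε hp hp (x := a) (by simpa using ha)
  rw [if_pos rfl] at this
  rw [← this]
  exact h.eigenProj_zero_mem hp hε a

theorem map_inv (h : IsCrossed p ε σ B t) (hε : ε ≠ 0) :
    σ ((t⁻¹ : Aˣ) : A) = ε⁻¹ • ((t⁻¹ : Aˣ) : A) := by
  have e : σ ((t⁻¹ : Aˣ) : A) * (ε • (t : A)) = 1 := by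
    rw [← h.map_unit, ← map_mul, Units.inv_mul, map_one]
  rw [mul_smul_comm] at e
  calc σ ((t⁻¹ : Aˣ) : A) = ε⁻¹ • (ε • (σ ((t⁻¹ : Aˣ) : A) * (t : A))) * ((t⁻¹ : Aˣ) : A) := by
        rw [smul_smul, inv_mul_cancel₀ hε, one_smul, mul_assoc, Units.mul_inv, mul_one]
    _ = _ := by rw [e, smul_mul_assoc, one_mul]

theorem eigenProj_mul_inv_pow_mem (h : IsCrossed p ε σ B t) (hp : 0 < p)
    (hε : IsPrimitiveRoot ε p) (j : ℕ) (a : A) :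
    eigenProj p ε σ.toLinearMap j a * ((t⁻¹ : Aˣ) : A) ^ j ∈ B := by
  have hε0 : ε ≠ 0 := hε.ne_zero hp.ne'
  have e := LinearMap.congr_fun (mul_eigenProj hp hε (h.pow_eq_one hε.pow_eq_one) j) a
  rw [Module.End.mul_apply, AlgHom.toLinearMap_apply, LinearMap.smul_apply] at e
  rw [h.mem_iff hp hε, map_mul, e, map_pow, h.map_inv hε0, smul_pow, smul_mul_smul_comm, inv_pow,
    mul_inv_cancel₀ (pow_ne_zero _ hε0), one_smul]

theorem eigenProj_mul (h : IsCrossed p ε σ B t) {v : A} (hv : v ∈ B) (j : ℕ) (a : A) :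
    eigenProj p ε σ.toLinearMap j (v * a) = v * eigenProj p ε σ.toLinearMap j a := by
  have hc : Commute (LinearMap.mulLeft K v) (σ.toLinearMap : Module.End K A) := by
    refine LinearMap.ext fun x => ?_
    simp [h.map_eq v hv]
  exact (LinearMap.congr_fun (commute_eigenProj (p := p) (ε := ε) hc j).eq a).symm

theorem mem_endImages_iff (h : IsCrossed p ε σ B t) (hp : 0 < p) (hε : IsPrimitiveRoot ε p) {v : A}
    (hv : v ∈ B) {w : A} : w ∈ endImages B v ↔ w ∈ endImages (⊤ : Subalgebra K A) v ∧ σ w = w := by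
  constructor
  · rintro ⟨⟨s, hs, rfl⟩, hw⟩
    refine ⟨⟨⟨s, trivial, rfl⟩, fun a _ ha => ?_⟩, h.map_eq _ (mul_mem hv hs)⟩
    have hj : ∀ j, v * s * eigenProj p ε σ.toLinearMap j a = 0 := by
      intro j
      have h1 := hw _ (h.eigenProj_mul_inv_pow_mem hp hε j a)
        (by rw [← mul_assoc, ← h.eigenProj_mul hv, ha, map_zero, zero_mul])
      rw [← mul_assoc] at h1
      calc _ = v * s * eigenProj p ε σ.toLinearMap j a * ((t⁻¹ : Aˣ) : A) ^ j * (t : A) ^ j := by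
            rw [mul_assoc _ (((t⁻¹ : Aˣ) : A) ^ j), ← Units.val_pow_eq_pow_val,
              ← Units.val_pow_eq_pow_val, inv_pow, Units.inv_mul, mul_one]
        _ = 0 := by rw [h1, zero_mul]
    have e := LinearMap.congr_fun (sum_eigenProj hp hε (σ.toLinearMap : Module.End K A)) a
    rw [LinearMap.sum_apply, Module.End.one_apply] at e
    rw [← e, Finset.mul_sum]
    exact Finset.sum_eq_zero fun j _ => hj j
  · rintro ⟨⟨⟨a, _, rfl⟩, hw⟩, hσ⟩
    refine ⟨⟨_, h.eigenProj_zero_mem hp hε a, ?_⟩, fun s _ hs => hw s trivial hs⟩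
    have := eigenProj_apply_of_eq (Φ := σ.toLinearMap) hp hε hp hp (x := v * a) (by simpa using hσ)
    rw [if_pos rfl] at this
    rw [← h.eigenProj_mul hv, this]

theorem map_mem_endImages_top (h : IsCrossed p ε σ B t) (hε : ε ^ p = 1) (hp : 0 < p) {v : A}
    (hv : v ∈ B) {w : A} (hw : w ∈ endImages (⊤ : Subalgebra K A) v) :
    σ w ∈ endImages (⊤ : Subalgebra K A) v := by
  have hinv : ∀ a, ∃ a', σ a' = a := by
    intro a
    have := LinearMap.congr_fun (h.pow_eq_one hε) a
    obtain ⟨k, rfl⟩ : ∃ k, p = k + 1 := ⟨p - 1, by omega⟩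
    rw [pow_succ'] at this
    exact ⟨_, this⟩
  have hinj : ∀ a, σ a = 0 → a = 0 := by
    intro a ha
    have := LinearMap.congr_fun (h.pow_eq_one hε) a
    obtain ⟨k, rfl⟩ : ∃ k, p = k + 1 := ⟨p - 1, by omega⟩
    rw [pow_succ, Module.End.mul_apply, AlgHom.toLinearMap_apply, ha, map_zero] at this
    exact this.symm
  obtain ⟨⟨s, -, rfl⟩, hw⟩ := hw
  refine ⟨⟨σ s, trivial, by rw [map_mul, h.map_eq v hv]⟩, fun a _ ha => ?_⟩
  obtain ⟨a', rfl⟩ := hinv a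
  rw [← map_mul, hw a' trivial, map_zero]
  exact hinj _ (by rw [map_mul, h.map_eq v hv, ha])

theorem finrank_endImages_top (h : IsCrossed p ε σ B t) (hp : 0 < p) (hε : IsPrimitiveRoot ε p)
    {v : A} (hv : v ∈ B) {u : Aˣ} (hu : v * t = u * v) :
    Module.finrank K (endImages (⊤ : Subalgebra K A) v) = p * Module.finrank K (endImages B v) := by
  have hu' : v * ((t⁻¹ : Aˣ) : A) = ((u⁻¹ : Aˣ) : A) * v := by
    calc v * ((t⁻¹ : Aˣ) : A) = ((u⁻¹ : Aˣ) : A) * (u * v) * ((t⁻¹ : Aˣ) : A) := by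
          rw [← mul_assoc, Units.inv_mul, one_mul]
      _ = _ := by rw [← hu, mul_assoc, mul_assoc, Units.mul_inv, mul_one]
  have hmul : ∀ (g s : Aˣ), v * s = g * v → ∀ w ∈ endImages (⊤ : Subalgebra K A) v,
      (LinearMap.mulLeft K (g : A)) w ∈ endImages (⊤ : Subalgebra K A) v := by
    rintro g s e _ ⟨⟨r, -, rfl⟩, hw⟩
    refine ⟨⟨s * r, trivial, ?_⟩, fun a _ ha => ?_⟩
    · rw [LinearMap.mulLeft_apply, ← mul_assoc, ← mul_assoc, e]
    · rw [LinearMap.mulLeft_apply, mul_assoc, hw a trivial ha, mul_zero]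
  have hσ : ∀ w ∈ endImages (⊤ : Subalgebra K A) v, σ.toLinearMap w ∈ endImages ⊤ v :=
    fun w hw => h.map_mem_endImages_top hε.pow_eq_one hp hv hw
  have hle : endImages B v ≤ endImages (⊤ : Subalgebra K A) v :=
    fun w hw => ((h.mem_endImages_iff hp hε hv).1 hw).1
  rw [← (Submodule.comapSubtypeEquivOfLe hle).finrank_eq]
  refine finrank_eq_mul_of_twist hp hε (σ.toLinearMap.restrict hσ)
    ((LinearMap.mulLeft K (u : A)).restrict (hmul u t hu))
    ((LinearMap.mulLeft K ((u⁻¹ : Aˣ) : A)).restrict (hmul u⁻¹ t⁻¹ hu')) ?_ ?_ ?_ ?_ _ ?_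
  · rw [Module.End.pow_restrict]
    refine LinearMap.ext fun w => Subtype.ext ?_
    exact LinearMap.congr_fun (h.pow_eq_one hε.pow_eq_one) w
  · refine LinearMap.ext fun w => Subtype.ext ?_
    simp
  · refine LinearMap.ext fun w => Subtype.ext ?_
    simp
  · refine LinearMap.ext fun w => Subtype.ext ?_
    obtain ⟨w, ⟨r, -, rfl⟩, hw⟩ := w
    simp only [Module.End.mul_apply, LinearMap.coe_restrict_apply, LinearMap.mulLeft_apply,
      AlgHom.toLinearMap_apply, LinearMap.smul_apply, Submodule.coe_smul]
    rw [← mul_assoc, ← hu, map_mul, map_mul, map_mul, h.map_unit, h.map_eq v hv, ← mul_assoc,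
      ← hu, mul_smul_comm, smul_mul_assoc]
  · intro w
    rw [Submodule.mem_comap, Submodule.subtype_apply, h.mem_endImages_iff hp hε hv, Subtype.ext_iff]
    simp

end IsCrossed

/-- Right multiplication by `a` on a subspace stable under all right multiplications. -/
def mulRightOn {K A : Type} [Field K] [Ring A] [Algebra K A] (V : Submodule K A)
    (hV : ∀ x ∈ V, ∀ a, x * a ∈ V) (a : A) : Module.End K V :=
  (LinearMap.mulRight K a).restrict fun x hx => hV x hx a

section mulRightOn
variable {K A : Type} [Field K] [Ring A] [Algebra K A] {V : Submodule K A}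
  {hV : ∀ x ∈ V, ∀ a, x * a ∈ V}

theorem mulRightOn_apply (a : A) (x : V) : (mulRightOn V hV a x : A) = x * a := rfl

theorem mulRightOn_mul (a b : A) :
    mulRightOn V hV (a * b) = mulRightOn V hV b * mulRightOn V hV a :=
  LinearMap.ext fun x => Subtype.ext (mul_assoc (x : A) a b).symm

theorem mulRightOn_pow (a : A) (k : ℕ) : mulRightOn V hV (a ^ k) = mulRightOn V hV a ^ k := by
  induction k with
  | zero => exact LinearMap.ext fun x => Subtype.ext (by simp [mulRightOn_apply])
  | succ k ih => rw [pow_succ', mulRightOn_mul, ih, pow_succ]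

theorem mulRightOn_mul_unit_inv (t : Aˣ) :
    mulRightOn V hV (t : A) * mulRightOn V hV ((t⁻¹ : Aˣ) : A) = 1 :=
  LinearMap.ext fun x => Subtype.ext (by simp [mulRightOn_apply])

theorem mulRightOn_unit_inv_mul (t : Aˣ) :
    mulRightOn V hV ((t⁻¹ : Aˣ) : A) * mulRightOn V hV (t : A) = 1 :=
  LinearMap.ext fun x => Subtype.ext (by simp [mulRightOn_apply])

theorem forall_commute_mulRightOn_iff {P : A → Prop} {f : Module.End K V} :
    (∀ a, P a → Commute f (mulRightOn V hV a)) ↔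
      ∀ (x y : V) (a : A), P a → (y : A) = x * a → (f y : A) = f x * a := by
  constructor
  · intro h x y a ha e
    obtain rfl : y = mulRightOn V hV a x := Subtype.ext e
    exact congrArg Subtype.val (LinearMap.congr_fun (h a ha).eq x)
  · intro h a ha
    exact LinearMap.ext fun x => Subtype.ext (h x _ a ha rfl)

end mulRightOn

namespace IsCrossed
variable {K A : Type} [Field K] [Ring A] [Algebra K A] {p : ℕ} {ε : K} {σ : A →ₐ[K] A}
  {B : Subalgebra K A} {t : Aˣ}

theorem finrank_end_restrict (h : IsCrossed p ε σ B t) (hp : 0 < p) (hε : IsPrimitiveRoot ε p)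
    (V : Submodule K A) (hV : ∀ x ∈ V, ∀ a, x * a ∈ V) (hσV : ∀ x ∈ V, σ.toLinearMap x ∈ V)
    (E E' : Submodule K (V →ₗ[K] V))
    (hE : ∀ f, f ∈ E ↔ ∀ (x y : V) (a : A), a ∈ B → (y : A) = x * a → (f y : A) = f x * a)
    (hE' : ∀ f, f ∈ E' ↔ ∀ (x y : V) (a : A), True → (y : A) = x * a → (f y : A) = f x * a) :
    Module.finrank K E = p * Module.finrank K E' := by
  have hε0 : ε ≠ 0 := hε.ne_zero hp.ne'
  simp only [← forall_commute_mulRightOn_iff (hV := hV)] at hE hE'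
  set R := mulRightOn V hV
  let s : Module.End K V := σ.toLinearMap.restrict hσV
  have hsp : s ^ p = 1 := by
    rw [show s = σ.toLinearMap.restrict hσV from rfl, Module.End.pow_restrict]
    exact LinearMap.ext fun w => Subtype.ext (LinearMap.congr_fun (h.pow_eq_one hε.pow_eq_one) w)
  have hsR : ∀ b ∈ B, Commute s (R b) := fun b hb => LinearMap.ext fun x => Subtype.ext <| by
    show σ (x * b) = σ x * b
    rw [map_mul, h.map_eq b hb]
  have hRs : R ((t⁻¹ : Aˣ) : A) * s = ε • (s * R ((t⁻¹ : Aˣ) : A)) :=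
    LinearMap.ext fun x => Subtype.ext <| by
      show σ x * ((t⁻¹ : Aˣ) : A) = ε • σ (x * ((t⁻¹ : Aˣ) : A))
      rw [map_mul, h.map_inv hε0, mul_smul_comm, smul_smul, mul_inv_cancel₀ hε0, one_smul]
  have hR1 : R (t : A) * R ((t⁻¹ : Aˣ) : A) = 1 := mulRightOn_mul_unit_inv t
  have hR2 : R ((t⁻¹ : Aˣ) : A) * R (t : A) = 1 := mulRightOn_unit_inv_mul t
  let Φ₀ : Module.End K (Module.End K V) :=
    LinearMap.mulLeft K (R ((t⁻¹ : Aˣ) : A)) * LinearMap.mulRight K (R (t : A))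
  have hΦ₀ : ∀ f, Φ₀ f = R ((t⁻¹ : Aˣ) : A) * (f * R (t : A)) := fun f => rfl
  have hΦE : ∀ f ∈ E, Φ₀ f ∈ E := by
    intro f hf
    rw [hE] at hf ⊢
    intro b hb
    have h1 : R (t : A) * R b = R (((t⁻¹ : Aˣ) : A) * b * t) * R (t : A) := by
      rw [← mulRightOn_mul, ← mulRightOn_mul, mul_assoc ((t⁻¹ : Aˣ) : A), ← mul_assoc (t : A),
        Units.mul_inv, one_mul]
    have h2 : R b * R ((t⁻¹ : Aˣ) : A) =
        R ((t⁻¹ : Aˣ) : A) * R (((t⁻¹ : Aˣ) : A) * b * t) := by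
      rw [← mulRightOn_mul, ← mulRightOn_mul, mul_assoc _ (t : A), Units.mul_inv, mul_one]
    have h3 := (hf _ (h.conj_inv_mem b hb)).eq
    show _ = _
    rw [hΦ₀]
    calc R ((t⁻¹ : Aˣ) : A) * (f * R (t : A)) * R b
        = R ((t⁻¹ : Aˣ) : A) * (f * (R (t : A) * R b)) := by simp only [mul_assoc]
      _ = R ((t⁻¹ : Aˣ) : A) * (f * R (((t⁻¹ : Aˣ) : A) * b * t)) * R (t : A) := by
          rw [h1]; simp only [mul_assoc]
      _ = _ := by rw [h3, ← mul_assoc (R ((t⁻¹ : Aˣ) : A)), ← h2]; simp only [mul_assoc]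
  have hSE : ∀ k, ∀ f ∈ E, LinearMap.mulLeft K (s ^ k) f ∈ E := by
    intro k f hf
    rw [hE] at hf ⊢
    exact fun b hb => ((hsR b hb).pow_left k).mul_left (hf b hb)
  have hle : E' ≤ E := fun f hf => (hE f).2 fun b _ => (hE' f).1 hf b trivial
  have hpow : ∀ (k : ℕ) f, (Φ₀ ^ k) f = R ((t⁻¹ : Aˣ) : A) ^ k * (f * R (t : A) ^ k) := by
    intro k f
    induction k with
    | zero => simp
    | succ k ih =>
      rw [pow_succ', Module.End.mul_apply, ih, hΦ₀, pow_succ', pow_succ]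
      simp only [mul_assoc]
  have hfix : ∀ f ∈ E, Φ₀ f = f → f ∈ E' := by
    intro f hf e
    have hft : Commute f (R (t : A)) := by
      show _ = _
      conv_rhs => rw [← e, hΦ₀, ← mul_assoc, hR1, one_mul]
    rw [hE']
    intro a _
    have := h.mem_span a
    induction this using Submodule.span_induction with
    | mem x hx =>
      obtain ⟨b, hb, k, rfl⟩ := hx
      rw [show R (b * (t : A) ^ k) = R (t : A) ^ k * R b by
        rw [← mulRightOn_pow, ← mulRightOn_mul]]
      exact (hft.pow_right k).mul_right ((hE f).1 hf b hb)
    | zero =>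
      rw [show R 0 = 0 from LinearMap.ext fun x => Subtype.ext (mul_zero _)]
      exact Commute.zero_right f
    | add x y _ _ hx hy =>
      rw [show R (x + y) = R x + R y from LinearMap.ext fun x => Subtype.ext (mul_add _ _ _)]
      exact hx.add_right hy
    | smul c x _ hx =>
      rw [show R (c • x) = c • R x from
        LinearMap.ext fun x => Subtype.ext (mul_smul_comm _ _ _)]
      exact hx.smul_right c
  obtain ⟨k, hk⟩ : ∃ k, p = k + 1 := ⟨p - 1, by omega⟩
  rw [← (Submodule.comapSubtypeEquivOfLe hle).finrank_eq]
  refine finrank_eq_mul_of_twist (E := E) hp hε (Φ₀.restrict hΦE)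
    ((LinearMap.mulLeft K (s ^ 1)).restrict (hSE 1))
    ((LinearMap.mulLeft K (s ^ k)).restrict (hSE k)) ?_ ?_ ?_ ?_ _ ?_
  · rw [Module.End.pow_restrict]
    refine LinearMap.ext fun f => Subtype.ext ?_
    show (Φ₀ ^ p) f = f
    have e1 := ((hE f).1 f.2 _ h.pow_mem).eq
    rw [show R ((t : A) ^ p) = R (t : A) ^ p from mulRightOn_pow _ _] at e1
    have hc : Commute (R ((t⁻¹ : Aˣ) : A)) (R (t : A)) := hR2.trans hR1.symm
    rw [hpow, e1, ← mul_assoc, ← hc.mul_pow, hR2, one_pow, one_mul]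
  · refine LinearMap.ext fun f => Subtype.ext ?_
    show s ^ 1 * (s ^ k * f) = f
    rw [← mul_assoc, ← pow_add, add_comm, ← hk, hsp, one_mul]
  · refine LinearMap.ext fun f => Subtype.ext ?_
    show s ^ k * (s ^ 1 * f) = f
    rw [← mul_assoc, ← pow_add, ← hk, hsp, one_mul]
  · refine LinearMap.ext fun f => Subtype.ext ?_
    show R ((t⁻¹ : Aˣ) : A) * (s ^ 1 * f * R (t : A)) =
      ε • (s ^ 1 * (R ((t⁻¹ : Aˣ) : A) * (f * R (t : A))))
    rw [pow_one, mul_assoc, ← mul_assoc _ s, hRs, smul_mul_assoc, mul_assoc]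
  · intro f
    rw [Submodule.mem_comap, Submodule.subtype_apply, Subtype.ext_iff]
    refine ⟨fun hf => ?_, fun e => hfix f f.2 e⟩
    show R ((t⁻¹ : Aˣ) : A) * (f * R (t : A)) = f
    rw [((hE' f).1 hf _ trivial).eq, ← mul_assoc, hR2, one_mul]

end IsCrossed

/-- `T_k ⋯ T_1`. -/
def descProd {M : Type} [Monoid M] (T : ℕ → M) : ℕ → M
  | 0 => 1
  | k + 1 => T (k + 1) * descProd T k

/-- `T_{k+1} ⋯ T_2`. -/
def descProdTwo {M : Type} [Monoid M] (T : ℕ → M) : ℕ → M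
  | 0 => 1
  | k + 1 => T (k + 2) * descProdTwo T k

/-- The braid relations among `T_1, …, T_{n-1}` and the commutations of `T_0, …, T_{n-1}`. -/
structure BraidGens {M : Type} [Monoid M] (T : ℕ → M) (n : ℕ) : Prop where
  braid : ∀ i, 1 ≤ i → i + 1 < n → T i * T (i + 1) * T i = T (i + 1) * T i * T (i + 1)
  comm : ∀ i j, i + 1 < j → j < n → Commute (T i) (T j)

namespace BraidGens
variable {M : Type} [Monoid M] {T : ℕ → M} {n : ℕ}

theorem commute_descProd_of_forall {x : M} {k : ℕ} (h : ∀ i, 1 ≤ i → i ≤ k → Commute x (T i)) :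
    Commute x (descProd T k) := by
  induction k with
  | zero => exact Commute.one_right _
  | succ k ih =>
    exact (h _ (by omega) le_rfl).mul_right (ih fun i h1 h2 => h i h1 (by omega))

theorem commute_descProd (hT : BraidGens T n) {j k : ℕ} (hkj : k + 1 < j) (hj : j < n) :
    Commute (T j) (descProd T k) :=
  commute_descProd_of_forall fun i _ h => (hT.comm i j (by omega) hj).symm

theorem descProd_mul_gen (hT : BraidGens T n) {i k : ℕ} (hi : 1 ≤ i) (hik : i + 1 ≤ k)
    (hk : k < n) : descProd T k * T (i + 1) = T i * descProd T k := by
  induction k with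
  | zero => omega
  | succ k ih =>
    rcases Nat.lt_or_ge i k with h | h
    · rw [descProd, mul_assoc, ih (by omega) (by omega), ← mul_assoc, ← mul_assoc,
        (hT.comm i (k + 1) (by omega) hk).eq]
    · obtain rfl : i = k := by omega
      obtain ⟨j, rfl⟩ : ∃ j, i = j + 1 := ⟨i - 1, by omega⟩
      have := hT.braid (j + 1) hi hk
      have hc := (hT.commute_descProd (j := j + 1 + 1) (k := j) (by omega) hk).eq
      calc T (j + 1 + 1) * (T (j + 1) * descProd T j) * T (j + 1 + 1)
          = T (j + 1 + 1) * T (j + 1) * (descProd T j * T (j + 1 + 1)) := by simp only [mul_assoc]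
        _ = T (j + 1) * T (j + 1 + 1) * T (j + 1) * descProd T j := by
            rw [← hc, this]; simp only [mul_assoc]
        _ = _ := by simp only [descProd, mul_assoc]

theorem descProd_eq (k : ℕ) : descProd T (k + 1) = descProdTwo T k * T 1 := by
  induction k with
  | zero => simp [descProd, descProdTwo]
  | succ k ih => rw [descProd, ih, descProdTwo, mul_assoc]

theorem descProd_mul_descProdTwo (hT : BraidGens T n) {j k : ℕ} (hjk : j + 1 ≤ k) (hk : k < n) :
    descProd T k * descProdTwo T j = descProd T j * descProd T k := by
  induction j with
  | zero => simp [descProd, descProdTwo]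
  | succ j ih =>
    rw [descProdTwo, ← mul_assoc, hT.descProd_mul_gen (by omega) (by omega) hk, mul_assoc,
      ih (by omega), descProd, mul_assoc]

theorem descProd_sq_mul (hT : BraidGens T n) {k : ℕ} (hk1 : 1 ≤ k) (hk : k < n) :
    descProd T k ^ 2 * T 1 = T k * descProd T k ^ 2 := by
  obtain ⟨j, rfl⟩ : ∃ j, k = j + 1 := ⟨k - 1, by omega⟩
  rw [sq]
  conv_rhs => rw [descProd_eq j]
  rw [← descProd_eq j, mul_assoc]
  conv_rhs => rw [descProd_eq j, ← mul_assoc, ← mul_assoc, mul_assoc (T (j+1)), ← descProd_eq j,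
    hT.descProd_mul_descProdTwo le_rfl hk, ← mul_assoc]
  rw [mul_assoc]
  rfl

theorem descProd_pow_mul_gen (hT : BraidGens T n) {i k m : ℕ} (hi : 1 ≤ i) (hik : i + m ≤ k)
    (hk : k < n) : descProd T k ^ m * T (i + m) = T i * descProd T k ^ m := by
  induction m with
  | zero => simp
  | succ m ih =>
    rw [pow_succ, mul_assoc, ← add_assoc, hT.descProd_mul_gen (by omega) (by omega) hk,
      ← mul_assoc, ih (by omega), mul_assoc]

theorem descProd_pow_mul_gen' (hT : BraidGens T n) {a c i k : ℕ} (hk : k + 1 = a + c) (hkn : k < n)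
    (hi : 1 ≤ i) (hic : i < c) : descProd T k ^ c * T i = T (i + a) * descProd T k ^ c := by
  obtain ⟨m, rfl⟩ : ∃ m, c = i + 1 + m := ⟨c - (i + 1), by omega⟩
  obtain ⟨j, rfl⟩ : ∃ j, i = j + 1 := ⟨i - 1, by omega⟩
  have e : j + 1 + 1 + m = m + (2 + j) := by omega
  have h1 := hT.descProd_pow_mul_gen (i := 1) (k := k) (m := j) le_rfl (by omega) hkn
  have h2 := hT.descProd_sq_mul (k := k) (by omega) hkn
  have h3 := hT.descProd_pow_mul_gen (i := j + 1 + a) (k := k) (m := m) (by omega) (by omega) hkn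
  have e2 : j + 1 + a + m = k := by omega
  rw [e2] at h3
  rw [e, pow_add, pow_add, mul_assoc, mul_assoc, add_comm j 1, h1, ← mul_assoc _ (T 1), h2,
    ← mul_assoc, ← mul_assoc, h3, add_comm 1 j]
  simp only [mul_assoc]

theorem exists_descProd_eq {k a : ℕ} (hak : a ≤ k) :
    ∃ E ∈ Submonoid.closure {x | ∃ i, a < i ∧ i ≤ k ∧ x = T i},
      descProd T k = E * descProd T a := by
  induction k, hak using Nat.le_induction with
  | base => exact ⟨1, one_mem _, by simp⟩
  | succ k hk ih =>
    obtain ⟨E, hE, h⟩ := ih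
    refine ⟨T (k + 1) * E, mul_mem (Submonoid.subset_closure ⟨k + 1, by omega, le_rfl, rfl⟩)
      (Submonoid.closure_mono ?_ hE), by rw [descProd, h, mul_assoc]⟩
    rintro _ ⟨i, h1, h2, rfl⟩
    exact ⟨i, h1, by omega, rfl⟩

theorem exists_descProd_mul (hT : BraidGens T n) {k a : ℕ} (ha : 1 ≤ a) (hk : k < n) {D : M}
    (hD : D ∈ Submonoid.closure {x | ∃ i, a < i ∧ i ≤ k ∧ x = T i}) :
    ∃ D' ∈ Submonoid.closure {x | ∃ i, a ≤ i ∧ i ≤ k ∧ x = T i},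
      descProd T k * D = D' * descProd T k := by
  induction hD using Submonoid.closure_induction with
  | mem x hx =>
    obtain ⟨i, h1, h2, rfl⟩ := hx
    obtain ⟨j, rfl⟩ : ∃ j, i = j + 1 := ⟨i - 1, by omega⟩
    exact ⟨T j, Submonoid.subset_closure ⟨j, by omega, by omega, rfl⟩,
      hT.descProd_mul_gen (by omega) h2 hk⟩
  | one => exact ⟨1, one_mem _, by simp⟩
  | mul x y _ _ hx hy =>
    obtain ⟨x', hx', ex⟩ := hx
    obtain ⟨y', hy', ey⟩ := hy
    exact ⟨x' * y', mul_mem hx' hy', by rw [← mul_assoc, ex, mul_assoc, ey, mul_assoc]⟩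

theorem descProdTwo_mem {k m : ℕ} (hmk : m + 1 ≤ k) :
    descProdTwo T m ∈ Submonoid.closure {x | ∃ i, 2 ≤ i ∧ i ≤ k ∧ x = T i} := by
  induction m with
  | zero => exact one_mem _
  | succ m ih =>
    exact mul_mem (Submonoid.subset_closure ⟨m + 2, by omega, by omega, rfl⟩) (ih (by omega))

/-- Factorization of the power `(T_k ⋯ T_1)^c` through `T_a ⋯ T_1`, where `a + c = k + 1`. -/
theorem exists_descProd_pow_eq (hT : BraidGens T n) {k c a : ℕ} (hk : k < n) (ha : 1 ≤ a)
    (hc : 1 ≤ c) (hac : a + c = k + 1) :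
    ∃ D ∈ Submonoid.closure {x | ∃ i, a < i ∧ i ≤ k ∧ x = T i},
    ∃ R ∈ Submonoid.closure {x | ∃ i, 2 ≤ i ∧ i ≤ k ∧ x = T i},
      descProd T k ^ c = D * descProd T a * R := by
  induction c, hc using Nat.le_induction generalizing a with
  | base =>
    obtain rfl : a = k := by omega
    exact ⟨1, one_mem _, 1, one_mem _, by simp⟩
  | succ c hc ih =>
    obtain ⟨D, hD, R, hR, e⟩ := ih (a := a + 1) (by omega) (by omega)
    obtain ⟨D', hD', e'⟩ := hT.exists_descProd_mul (by omega) hk hD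
    obtain ⟨E, hE, eE⟩ := exists_descProd_eq (T := T) (k := k) (a := a) (by omega)
    refine ⟨D' * E * T (a + 1), mul_mem (mul_mem (Submonoid.closure_mono ?_ hD') hE)
      (Submonoid.subset_closure ⟨a + 1, by omega, by omega, rfl⟩), descProdTwo T a * R,
      mul_mem (descProdTwo_mem (by omega)) hR, ?_⟩
    · rintro _ ⟨i, h1, h2, rfl⟩
      exact ⟨i, by omega, h2, rfl⟩
    · have h1 := hT.descProd_mul_descProdTwo (j := a) (k := a + 1) le_rfl (by omega)
      calc descProd T k ^ (c + 1) = descProd T k * D * descProd T (a + 1) * R := by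
            rw [pow_succ', e]; simp only [mul_assoc]
        _ = D' * E * (descProd T a * descProd T (a + 1)) * R := by
            rw [e', eE]; simp only [mul_assoc]
        _ = _ := by rw [← h1, descProd]; simp only [mul_assoc]

end BraidGens

/-- Generators `T_0, …, T_{n-1}` satisfying the type `B` Hecke relations, with the associated
Jucys–Murphy elements `L_1, …, L_n`. -/
structure HeckeGens {K A : Type} [Field K] [Ring A] [Algebra K A] (q : K) (n : ℕ)
    (T L : ℕ → A) : Prop extends BraidGens T n where
  q_ne : q ≠ 0
  braid01 : 1 < n → T 0 * T 1 * T 0 * T 1 = T 1 * T 0 * T 1 * T 0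
  quad : ∀ i, 1 ≤ i → i < n → (T i + 1) * (T i - algebraMap K A q) = 0
  L_one : L 1 = T 0
  L_succ : ∀ k, 1 ≤ k → k < n → L (k + 1) = q⁻¹ • (T k * L k * T k)

namespace HeckeGens
variable {K A : Type} [Field K] [Ring A] [Algebra K A] {q : K} {n : ℕ} {T L : ℕ → A}

theorem gen_mul_self (h : HeckeGens q n T L) {i : ℕ} (hi : 1 ≤ i) (hn : i < n) :
    T i * T i = (q - 1) • T i + q • 1 := by
  have := h.quad i hi hn
  rw [add_mul, mul_sub, one_mul, ← Algebra.commutes, ← Algebra.smul_def,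
    Algebra.algebraMap_eq_smul_one] at this
  rw [sub_smul, one_smul, ← sub_eq_zero, ← this]
  abel

theorem commute_gen_L_of_lt (h : HeckeGens q n T L) {i m : ℕ} (hm : 1 ≤ m) (him : m < i)
    (hi : i < n) : Commute (T i) (L m) := by
  induction m, hm using Nat.le_induction with
  | base => rw [h.L_one]; exact (h.comm 0 i (by omega) hi).symm
  | succ m hm ih =>
    rw [h.L_succ m hm (by omega)]
    have h1 : Commute (T i) (T m) := (h.comm m i (by omega) hi).symm
    exact ((h1.mul_right (ih (by omega))).mul_right h1).smul_right _

theorem commute_gen_L_of_gt (h : HeckeGens q n T L) {j m : ℕ} (hj : 1 ≤ j) (hjm : j + 2 ≤ m)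
    (hm : m ≤ n) : Commute (T j) (L m) := by
  induction m, hjm using Nat.le_induction with
  | base =>
    rw [show j + 2 = j + 1 + 1 from rfl, h.L_succ (j + 1) (by omega) (by omega),
      h.L_succ j hj (by omega), mul_smul_comm, smul_mul_assoc]
    refine Commute.smul_right (Commute.smul_right ?_ _) _
    have b := h.braid j hj (by omega)
    have c := (h.commute_gen_L_of_lt hj (Nat.lt_succ_self j) (by omega)).eq
    show _ = _
    calc T j * (T (j + 1) * (T j * L j * T j) * T (j + 1))
        = T j * T (j + 1) * T j * L j * T j * T (j + 1) := by simp only [mul_assoc]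
      _ = T (j + 1) * T j * (T (j + 1) * L j) * T j * T (j + 1) := by
          rw [b]; simp only [mul_assoc]
      _ = T (j + 1) * T j * L j * (T (j + 1) * T j * T (j + 1)) := by
          rw [c]; simp only [mul_assoc]
      _ = _ := by rw [← b]; simp only [mul_assoc]
  | succ m hjm ih =>
    rw [h.L_succ m (by omega) (by omega)]
    have h1 : Commute (T j) (T m) := h.comm j m (by omega) (by omega)
    exact ((h1.mul_right (ih (by omega))).mul_right h1).smul_right _

theorem commute_gen_zero_L (h : HeckeGens q n T L) {m : ℕ} (hm : 1 ≤ m) (hn : m ≤ n) :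
    Commute (T 0) (L m) := by
  induction m, hm using Nat.le_induction with
  | base => rw [h.L_one]
  | succ m hm ih =>
    rw [h.L_succ m hm (by omega)]
    refine Commute.smul_right ?_ _
    rcases Nat.lt_or_ge 1 m with h1 | h1
    · have h2 : Commute (T 0) (T m) := h.comm 0 m h1 (by omega)
      exact (h2.mul_right (ih (by omega))).mul_right h2
    · obtain rfl : m = 1 := by omega
      rw [h.L_one]
      show _ = _
      simpa only [mul_assoc] using h.braid01 (by omega)

theorem commute_L_L (h : HeckeGens q n T L) {i j : ℕ} (hi : 1 ≤ i) (hin : i ≤ n) (hj : 1 ≤ j)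
    (hjn : j ≤ n) : Commute (L i) (L j) := by
  wlog hij : i ≤ j generalizing i j
  · exact (this hj hjn hi hin (by omega)).symm
  induction i, hi using Nat.le_induction with
  | base => rw [h.L_one]; exact h.commute_gen_zero_L hj hjn
  | succ i hi ih =>
    rcases hij.eq_or_lt with rfl | hlt
    · exact Commute.refl _
    · rw [h.L_succ i hi (by omega)]
      have h1 : Commute (T i) (L j) := h.commute_gen_L_of_gt hi (by omega) hjn
      exact ((h1.mul_left (ih (by omega) (by omega))).mul_left h1).smul_left _

theorem gen_mul_L_succ (h : HeckeGens q n T L) {i : ℕ} (hi : 1 ≤ i) (hn : i < n) :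
    T i * L (i + 1) = (q - 1) • L (i + 1) + L i * T i := by
  rw [h.L_succ i hi hn, mul_smul_comm, ← mul_assoc, ← mul_assoc, h.gen_mul_self hi hn,
    smul_comm (q - 1), add_mul, add_mul, smul_add]
  simp [smul_smul, inv_mul_cancel₀ h.q_ne, mul_assoc]

theorem L_succ_mul_gen (h : HeckeGens q n T L) {i : ℕ} (hi : 1 ≤ i) (hn : i < n) :
    L (i + 1) * T i = (q - 1) • L (i + 1) + T i * L i := by
  rw [h.L_succ i hi hn, smul_mul_assoc, mul_assoc, h.gen_mul_self hi hn,
    smul_comm (q - 1), mul_add, smul_add]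
  simp [smul_smul, inv_mul_cancel₀ h.q_ne, mul_assoc]

theorem commute_gen_add (h : HeckeGens q n T L) {i : ℕ} (hi : 1 ≤ i) (hn : i < n) :
    Commute (T i) (L i + L (i + 1)) := by
  show _ = _
  rw [mul_add, add_mul, h.gen_mul_L_succ hi hn, h.L_succ_mul_gen hi hn]
  abel

theorem commute_gen_mul (h : HeckeGens q n T L) {i : ℕ} (hi : 1 ≤ i) (hn : i < n) :
    Commute (T i) (L i * L (i + 1)) := by
  have e : T i * (L i * L (i + 1)) = L (i + 1) * L i * T i := by
    rw [h.L_succ i hi hn]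
    simp only [mul_smul_comm, smul_mul_assoc, mul_assoc]
  rw [(h.commute_L_L (by omega) (by omega) (by omega) (by omega) :
    Commute (L (i + 1)) (L i)).eq] at e
  exact e

theorem commute_gen_pow_add (h : HeckeGens q n T L) {i : ℕ} (hi : 1 ≤ i) (hn : i < n) (p : ℕ) :
    Commute (T i) (L i ^ p + L (i + 1) ^ p) := by
  have hc : Commute (L i) (L (i + 1)) := h.commute_L_L hi (by omega) (by omega) (by omega)
  induction p using Nat.strong_induction_on with
  | _ p ih =>
    match p with
    | 0 => simp only [pow_zero]; exact (Commute.one_right _).add_right (Commute.one_right _)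
    | 1 => simpa using h.commute_gen_add hi hn
    | p + 2 =>
      have e : L i ^ (p + 2) + L (i + 1) ^ (p + 2) =
          (L i + L (i + 1)) * (L i ^ (p + 1) + L (i + 1) ^ (p + 1)) -
            L i * L (i + 1) * (L i ^ p + L (i + 1) ^ p) := by
        have e1 : L i * L (i + 1) * L i ^ p = L (i + 1) * L i ^ (p + 1) := by
          rw [hc.eq, mul_assoc, ← pow_succ']
        have e2 : L i * L (i + 1) * L (i + 1) ^ p = L i * L (i + 1) ^ (p + 1) := by
          rw [mul_assoc, ← pow_succ']
        rw [mul_add (L i * L (i + 1)), e1, e2, add_mul, mul_add, mul_add, ← pow_succ', ← pow_succ']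
        abel
      rw [e]
      exact ((h.commute_gen_add hi hn).mul_right (ih _ (by omega))).sub_right
        ((h.commute_gen_mul hi hn).mul_right (ih _ (by omega)))

end HeckeGens

/-- The product `∏_{m=1}^{M} (L_m^p - c)`. -/
def levelProd {K A : Type} [Field K] [Ring A] [Algebra K A] (L : ℕ → A) (p M : ℕ) (c : K) : A :=
  ((List.range M).map fun m => L (m + 1) ^ p - algebraMap K A c).prod

section levelProd
variable {K A : Type} [Field K] [Ring A] [Algebra K A] {q : K} {n : ℕ} {T L : ℕ → A}

theorem levelProd_succ (p M : ℕ) (c : K) :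
    levelProd L p (M + 1) c = levelProd L p M c * (L (M + 1) ^ p - algebraMap K A c) := by
  simp [levelProd, List.range_succ]

theorem commute_L_pow_sub {x : A} {m : ℕ} (p : ℕ) (c : K) (h : Commute x (L m)) :
    Commute x (L m ^ p - algebraMap K A c) :=
  (h.pow_right p).sub_right (Algebra.commutes c x).symm

theorem commute_levelProd_of_forall {x : A} {M : ℕ} (p : ℕ) (c : K)
    (h : ∀ m, 1 ≤ m → m ≤ M → Commute x (L m)) : Commute x (levelProd L p M c) := by
  refine Commute.list_prod_right _ _ fun y hy => ?_
  obtain ⟨m, hm, rfl⟩ := List.mem_map.1 hy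
  have := List.mem_range.1 hm
  exact commute_L_pow_sub p c (h _ (by omega) (by omega))

namespace HeckeGens

theorem commute_gen_levelProd (h : HeckeGens q n T L) {i M : ℕ} (p : ℕ) (c : K) (hi : i < n)
    (hM : M ≤ n) (hiM : i ≠ M ∨ i = 0) : Commute (T i) (levelProd L p M c) := by
  rcases Nat.eq_zero_or_pos i with rfl | hi0
  · exact commute_levelProd_of_forall p c fun m h1 h2 => h.commute_gen_zero_L h1 (by omega)
  rcases Nat.lt_or_ge M i with hlt | hge
  · exact commute_levelProd_of_forall p c fun m h1 h2 => h.commute_gen_L_of_lt h1 (by omega) hi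
  have hlt : i + 1 ≤ M := by omega
  clear hge hiM
  induction M, hlt using Nat.le_induction with
  | base =>
    obtain ⟨j, rfl⟩ : ∃ j, i = j + 1 := ⟨i - 1, by omega⟩
    rw [levelProd_succ, levelProd_succ, mul_assoc]
    refine (commute_levelProd_of_forall p c fun m h1 h2 =>
      h.commute_gen_L_of_lt h1 (by omega) hi).mul_right ?_
    have hc : Commute (L (j + 1)) (L (j + 1 + 1)) :=
      h.commute_L_L hi0 (by omega) (by omega) (by omega)
    have e : (L (j + 1) ^ p - algebraMap K A c) * (L (j + 1 + 1) ^ p - algebraMap K A c) =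
        (L (j + 1) * L (j + 1 + 1)) ^ p -
          algebraMap K A c * (L (j + 1) ^ p + L (j + 1 + 1) ^ p) +
          algebraMap K A c * algebraMap K A c := by
      rw [hc.mul_pow, sub_mul, mul_sub, mul_sub, mul_add, ← Algebra.commutes c (L (j + 1) ^ p)]
      abel
    rw [e]
    have hac : Commute (T (j + 1)) (algebraMap K A c) := (Algebra.commutes c _).symm
    exact (((h.commute_gen_mul hi0 hi).pow_right p).sub_right
      (hac.mul_right (h.commute_gen_pow_add hi0 hi p))).add_right (hac.mul_right hac)
  | succ M hlt ih =>
    rw [levelProd_succ]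
    exact (ih (by omega)).mul_right
      (commute_L_pow_sub p c (h.commute_gen_L_of_gt hi0 (by omega) hM))

end HeckeGens
end levelProd

/-- The group of units generated by the nonzero scalars, `T_0` and the `T_i` with `i < c`. -/
def genUnits (K : Type) {A : Type} [Field K] [Ring A] [Algebra K A] (T : ℕ → A) (c : ℕ) :
    Subgroup Aˣ :=
  Subgroup.closure {g | (∃ i, (i = 0 ∨ i < c) ∧ (g : A) = T i) ∨ ∃ x : K, (g : A) = algebraMap K A x}

namespace HeckeGens
variable {K A : Type} [Field K] [Ring A] [Algebra K A] {q : K} {n : ℕ} {T L : ℕ → A}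

theorem isUnit_gen (h : HeckeGens q n T L) (hT0 : IsUnit (T 0)) {i : ℕ} (hi : i < n) :
    IsUnit (T i) := by
  rcases Nat.eq_zero_or_pos i with rfl | h0
  · exact hT0
  · have e := h.gen_mul_self h0 hi
    have e1 : T i * (q⁻¹ • (T i - (q - 1) • 1)) = 1 := by
      rw [mul_smul_comm, mul_sub, e, mul_smul_comm, mul_one, add_sub_cancel_left, smul_smul,
        inv_mul_cancel₀ h.q_ne, one_smul]
    have e2 : (q⁻¹ • (T i - (q - 1) • 1)) * T i = 1 := by
      rw [smul_mul_assoc, sub_mul, e, smul_mul_assoc, one_mul, add_sub_cancel_left, smul_smul,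
        inv_mul_cancel₀ h.q_ne, one_smul]
    exact ⟨⟨_, _, e1, e2⟩, rfl⟩

theorem exists_genUnits_eq_gen (h : HeckeGens q n T L) (hT0 : IsUnit (T 0)) {i c : ℕ} (hi : i < n)
    (hic : i = 0 ∨ i < c) : ∃ g ∈ genUnits K T c, (g : A) = T i :=
  ⟨(h.isUnit_gen hT0 hi).unit, Subgroup.subset_closure (Or.inl ⟨i, hic, rfl⟩), rfl⟩

theorem exists_genUnits_eq_of_mem_closure (h : HeckeGens q n T L) (hT0 : IsUnit (T 0))
    {s : Set A} {c : ℕ} (hc : c ≤ n) (hs : ∀ x ∈ s, ∃ i < c, x = T i) {x : A}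
    (hx : x ∈ Submonoid.closure s) : ∃ g ∈ genUnits K T c, (g : A) = x := by
  induction hx using Submonoid.closure_induction with
  | mem x hx =>
    obtain ⟨i, h2, rfl⟩ := hs x hx
    exact h.exists_genUnits_eq_gen hT0 (by omega) (Or.inr h2)
  | one => exact ⟨1, one_mem _, rfl⟩
  | mul x y _ _ hx hy =>
    obtain ⟨a, ha, rfl⟩ := hx
    obtain ⟨b, hb, rfl⟩ := hy
    exact ⟨a * b, mul_mem ha hb, rfl⟩

theorem exists_genUnits_eq_L (h : HeckeGens q n T L) (hT0 : IsUnit (T 0)) {m c : ℕ} (hm : 1 ≤ m)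
    (hn : m ≤ n) (hc : m ≤ c) : ∃ g ∈ genUnits K T c, (g : A) = L m := by
  induction m, hm using Nat.le_induction with
  | base =>
    rw [h.L_one]
    exact h.exists_genUnits_eq_gen hT0 (by omega) (Or.inl rfl)
  | succ m hm ih =>
    obtain ⟨l, hl, el⟩ := ih (by omega) (by omega)
    obtain ⟨t, ht, et⟩ := h.exists_genUnits_eq_gen hT0 (i := m) (c := c) (by omega) (Or.inr hc)
    let s : Aˣ := Units.map (algebraMap K A).toMonoidHom (Units.mk0 q h.q_ne)⁻¹
    have hs : s ∈ genUnits K T c := Subgroup.subset_closure (Or.inr ⟨q⁻¹, rfl⟩)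
    refine ⟨s * (t * l * t), mul_mem hs (mul_mem (mul_mem ht hl) ht), ?_⟩
    rw [h.L_succ m hm (by omega), Algebra.smul_def, ← et, ← el]
    rfl

end HeckeGens

section genUnits
variable {K A : Type} [Field K] [Ring A] [Algebra K A] {q : K} {n : ℕ} {T L : ℕ → A}

theorem commute_of_mem_genUnits {c : ℕ} {x : A} (hx : ∀ i, (i = 0 ∨ i < c) → Commute x (T i))
    {g : Aˣ} (hg : g ∈ genUnits K T c) : Commute x (g : A) := by
  induction hg using Subgroup.closure_induction with
  | mem g hg =>
    rcases hg with ⟨i, hi, e⟩ | ⟨y, e⟩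
    · rw [e]; exact hx i hi
    · rw [e]; exact (Algebra.commutes y x).symm
  | one => exact Commute.one_right x
  | mul a b _ _ ha hb => rw [Units.val_mul]; exact ha.mul_right hb
  | inv a _ ha => exact ha.units_inv_right

theorem exists_genUnits_mul_eq {c c' : ℕ} {v W : A}
    (hW : ∀ i, (i = 0 ∨ i < c) → Commute W (T i))
    (hv : ∀ i, (i = 0 ∨ i < c) → ∃ g ∈ genUnits K T c', v * T i * W = g * v * W)
    {g : Aˣ} (hg : g ∈ genUnits K T c) : ∃ g' ∈ genUnits K T c', v * g * W = g' * v * W := by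
  induction hg using Subgroup.closure_induction with
  | mem g hg =>
    rcases hg with ⟨i, hi, e⟩ | ⟨y, e⟩
    · rw [e]; exact hv i hi
    · exact ⟨g, Subgroup.subset_closure (Or.inr ⟨y, e⟩), by rw [e, Algebra.commutes]⟩
  | one => exact ⟨1, one_mem _, by simp⟩
  | mul a b ha hb iha ihb =>
    obtain ⟨a', ha', ea⟩ := iha
    obtain ⟨b', hb', eb⟩ := ihb
    have cb := (commute_of_mem_genUnits hW hb).eq
    refine ⟨a' * b', mul_mem ha' hb', ?_⟩
    calc v * ((a * b : Aˣ) : A) * W = v * a * (b * W) := by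
          rw [Units.val_mul]; simp only [mul_assoc]
      _ = (v * a * W) * b := by rw [← cb]; simp only [mul_assoc]
      _ = a' * (v * (W * b)) := by rw [ea]; simp only [mul_assoc]
      _ = a' * (v * b * W) := by rw [cb]; simp only [mul_assoc]
      _ = _ := by rw [eb, Units.val_mul]; simp only [mul_assoc]
  | inv a ha iha =>
    obtain ⟨a', ha', ea⟩ := iha
    have ca := (commute_of_mem_genUnits hW ha).eq
    have ci := (commute_of_mem_genUnits hW (inv_mem ha)).eq
    refine ⟨a'⁻¹, inv_mem ha', ?_⟩
    have e : v * W = a' * (v * ((a⁻¹ : Aˣ) : A) * W) := by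
      calc v * W = v * (W * a) * ((a⁻¹ : Aˣ) : A) := by simp [mul_assoc]
        _ = (v * a * W) * ((a⁻¹ : Aˣ) : A) := by rw [ca]; simp only [mul_assoc]
        _ = a' * (v * (W * ((a⁻¹ : Aˣ) : A))) := by rw [ea]; simp only [mul_assoc]
        _ = _ := by rw [ci]; simp only [mul_assoc]
    rw [mul_assoc ((a'⁻¹ : Aˣ) : A) v W, e, ← mul_assoc, Units.inv_mul, one_mul]

theorem commute_of_mem_closure {s : Set A} {x y : A} (hx : ∀ z ∈ s, Commute x z)
    (hy : y ∈ Submonoid.closure s) : Commute x y := by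
  induction hy using Submonoid.closure_induction with
  | mem z hz => exact hx z hz
  | one => exact Commute.one_right x
  | mul a b _ _ ha hb => exact ha.mul_right hb

end genUnits

namespace HeckeGens
variable {K A : Type} [Field K] [Ring A] [Algebra K A] {q : K} {n : ℕ} {T L : ℕ → A}

theorem mul_descProd_mul_L_one (h : HeckeGens q n T L) {a : ℕ} (ha : a < n) {u U : A}
    (hu : ∀ i < a, Commute u (T i)) (huU : u * U = 0)
    (hUL : ∀ m, 1 ≤ m → m ≤ n → Commute U (L m))
    (hUT : ∀ i, 2 ≤ i → i < n → Commute U (T i)) {j : ℕ} (hj : j ≤ a) {Y : A} (hYU : Commute Y U)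
    (hY : ∀ i, 1 ≤ i → i < j → Commute Y (T i)) :
    u * Y * descProd T j * L 1 * U = u * Y * L (j + 1) * descProd T j * U := by
  induction j generalizing Y with
  | zero => simp [descProd]
  | succ j ih =>
    have e1 : u * Y * descProd T (j + 1) * L 1 * U =
        u * (Y * T (j + 1)) * L (j + 1) * descProd T j * U := by
      rcases Nat.eq_zero_or_pos j with rfl | hj0
      · simp [descProd, mul_assoc]
      · rw [← ih (by omega) (hYU.mul_left (hUT (j + 1) (by omega) (by omega)).symm)]
        · simp only [descProd, mul_assoc]
        · intro i h1 h2
          exact (hY i h1 (by omega)).mul_left (h.comm i (j + 1) (by omega) (by omega)).symm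
    have cdu : Commute u (descProd T j) :=
      BraidGens.commute_descProd_of_forall fun i _ h2 => hu i (by omega)
    have cdY : Commute Y (descProd T j) :=
      BraidGens.commute_descProd_of_forall fun i h1 h2 => hY i h1 (by omega)
    have cdL : Commute (L (j + 1 + 1)) (descProd T j) :=
      BraidGens.commute_descProd_of_forall fun i h1 h2 =>
        (h.commute_gen_L_of_gt h1 (by omega) (by omega)).symm
    have e2 : u * Y * L (j + 1 + 1) * descProd T j * U = 0 := by
      calc u * Y * L (j + 1 + 1) * descProd T j * U
          = u * (Y * L (j + 1 + 1) * descProd T j) * U := by simp only [mul_assoc]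
        _ = (u * descProd T j) * (Y * L (j + 1 + 1) * U) := by
            rw [(cdY.mul_left cdL).eq]; simp only [mul_assoc]
        _ = descProd T j * (u * U * (Y * L (j + 1 + 1))) := by
            rw [(hYU.mul_left (hUL _ (by omega) (by omega)).symm).eq, cdu.eq]
            simp only [mul_assoc]
        _ = 0 := by rw [huU]; simp
    have e3 : T (j + 1) * L (j + 1) =
        L (j + 1 + 1) * T (j + 1) - (q - 1) • L (j + 1 + 1) := by
      rw [h.L_succ_mul_gen (by omega) (by omega)]; abel
    rw [e1, mul_assoc u, mul_assoc Y, e3]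
    have e4 : u * (Y * (L (j + 1 + 1) * T (j + 1) - (q - 1) • L (j + 1 + 1))) * descProd T j * U =
        u * Y * L (j + 1 + 1) * descProd T (j + 1) * U -
          (q - 1) • (u * Y * L (j + 1 + 1) * descProd T j * U) := by
      simp only [descProd, mul_sub, sub_mul, mul_smul_comm, smul_mul_assoc, mul_assoc]
    rw [e4, e2, smul_zero, sub_zero]

theorem exists_genUnits_mul_descProd_pow (h : HeckeGens q n T L) (hT0 : IsUnit (T 0)) {a c : ℕ}
    (hn : 1 ≤ n) (hac : a + c ≤ n) {u W : A} (hu0 : Commute u (T 0))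
    (hu : ∀ i < n, i ≠ a → Commute u (T i)) (huL : ∀ m, 1 ≤ m → m ≤ n → Commute u (L m))
    (hW : ∀ i, (i = 0 ∨ i < c) → Commute W (T i))
    (hWU : 1 ≤ a → 1 ≤ c → ∃ U W', W = U * W' ∧ u * U = 0 ∧
      (∀ m, 1 ≤ m → m ≤ n → Commute U (L m)) ∧ ∀ i, 2 ≤ i → i < n → Commute U (T i))
    {i : ℕ} (hi : i = 0 ∨ i < c) :
    ∃ g ∈ genUnits K T (a + c), (u * descProd T (a + c - 1) ^ c) * T i * W =
      g * (u * descProd T (a + c - 1) ^ c) * W := by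
  have hin : i < n := by omega
  rcases Nat.eq_zero_or_pos c with rfl | hc
  · obtain rfl : i = 0 := by omega
    obtain ⟨g, hg, e⟩ := h.exists_genUnits_eq_gen hT0 (i := 0) (c := a + 0) hin (Or.inl rfl)
    exact ⟨g, hg, by rw [e, pow_zero, mul_one, hu0.eq]⟩
  rcases Nat.eq_zero_or_pos a with rfl | ha
  · obtain ⟨g, hg, e⟩ := h.exists_genUnits_eq_gen hT0 (i := i) (c := 0 + c) hin (by omega)
    obtain ⟨E, hE, eE⟩ := BraidGens.exists_descProd_eq (T := T) (k := 0 + c - 1) (a := 0) (by omega)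
    obtain ⟨d, hd, ed⟩ := h.exists_genUnits_eq_of_mem_closure hT0 (c := 0 + c) (by omega) (by
      rintro _ ⟨i, h1, h2, rfl⟩
      exact ⟨i, by omega, rfl⟩) hE
    have e1 : descProd T (0 + c - 1) ^ c = ((d ^ c : Aˣ) : A) := by
      rw [eE, descProd, mul_one, ← ed, Units.val_pow_eq_pow_val]
    have cu : Commute u (descProd T (0 + c - 1) ^ c) :=
      (BraidGens.commute_descProd_of_forall fun i h1 h2 => hu i (by omega) (by omega)).pow_right _
    have cT : Commute u (T i) := by
      rcases Nat.eq_zero_or_pos i with rfl | h0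
      · exact hu0
      · exact hu i hin (by omega)
    rw [e1] at cu ⊢
    refine ⟨d ^ c * g * (d ^ c)⁻¹, mul_mem (mul_mem (pow_mem hd _) hg) (inv_mem (pow_mem hd _)), ?_⟩
    rw [cu.eq, Units.val_mul, Units.val_mul, e]
    calc ((d ^ c : Aˣ) : A) * u * T i * W = ((d ^ c : Aˣ) : A) * (u * T i) * W := by
          simp only [mul_assoc]
      _ = ((d ^ c : Aˣ) : A) * T i * (((d ^ c)⁻¹ : Aˣ) * ((d ^ c : Aˣ) : A)) * u * W := by
          rw [cT.eq]; simp only [mul_assoc, Units.inv_mul, one_mul]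
      _ = _ := by simp only [mul_assoc]
  rcases Nat.eq_zero_or_pos i with rfl | hi0
  · obtain ⟨U, W', rfl, huU, hUL, hUT⟩ := hWU ha hc
    obtain ⟨D, hD, R, hR, e⟩ := h.exists_descProd_pow_eq (k := a + c - 1) (c := c) (a := a)
      (by omega) ha hc (by omega)
    obtain ⟨d, hd, ed⟩ := h.exists_genUnits_eq_of_mem_closure hT0 (c := a + c) (by omega) (by
      rintro _ ⟨i, h1, h2, rfl⟩
      exact ⟨i, by omega, rfl⟩) hD
    obtain ⟨l, hl, el⟩ := h.exists_genUnits_eq_L hT0 (m := a + 1) (c := a + c) (by omega)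
      (by omega) (by omega)
    have cuD : Commute u D := commute_of_mem_closure (by
      rintro _ ⟨i, h1, h2, rfl⟩
      exact hu i (by omega) (by omega)) hD
    have cUR : Commute U R := commute_of_mem_closure (by
      rintro _ ⟨i, h1, h2, rfl⟩
      exact hUT i h1 (by omega)) hR
    have cLR : Commute (T 0) R := commute_of_mem_closure (by
      rintro _ ⟨i, h1, h2, rfl⟩
      exact h.comm 0 i (by omega) (by omega)) hR
    have key := h.mul_descProd_mul_L_one (a := a) (by omega) (u := u) (U := U)
      (fun i hi => hu i (by omega) (by omega)) huU hUL hUT le_rfl (Y := 1) (Commute.one_left _)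
      (fun i _ _ => Commute.one_left _)
    rw [mul_one] at key
    refine ⟨d * l * d⁻¹, mul_mem (mul_mem hd hl) (inv_mem hd), ?_⟩
    rw [e, Units.val_mul, Units.val_mul, el]
    calc u * (D * descProd T a * R) * T 0 * (U * W')
        = (u * D) * descProd T a * (R * T 0) * U * W' := by simp only [mul_assoc]
      _ = D * u * descProd T a * T 0 * (R * U) * W' := by
          rw [← cLR.eq, cuD.eq]; simp only [mul_assoc]
      _ = D * (u * descProd T a * L 1 * U) * R * W' := by
          rw [← cUR.eq, h.L_one]; simp only [mul_assoc]
      _ = D * (u * L (a + 1)) * descProd T a * (U * R) * W' := by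
          rw [key]; simp only [mul_assoc]
      _ = D * L (a + 1) * (u * descProd T a * R * U * W') := by
          rw [(huL (a + 1) (by omega) (by omega)).eq, cUR.eq]; simp only [mul_assoc]
      _ = D * L (a + 1) * (((d⁻¹ : Aˣ) : A) * (D * u)) * descProd T a * R * U * W' := by
          rw [← mul_assoc ((d⁻¹ : Aˣ) : A) D u, ← ed, Units.inv_mul, one_mul]
          simp only [mul_assoc]
      _ = _ := by rw [← cuD.eq, ← ed]; simp only [mul_assoc]
  · obtain ⟨g, hg, e⟩ := h.exists_genUnits_eq_gen hT0 (i := i + a) (c := a + c) (by omega) (by omega)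
    refine ⟨g, hg, ?_⟩
    rw [mul_assoc u, h.descProd_pow_mul_gen' (a := a) (c := c) (by omega) (by omega) hi0 (by omega), e,
      ← mul_assoc u, (hu (i + a) (by omega) (by omega)).eq]
    simp only [mul_assoc]

end HeckeGens

theorem exists_list_prod_factor {ι A : Type} [Monoid A] {S : Submonoid A}
    (hS : ∀ x ∈ S, ∀ y ∈ S, Commute x y) (l : List ι) (f g : ι → A)
    (hg : ∀ i ∈ l, g i ∈ S) (hfg : ∀ i ∈ l, ∃ z ∈ S, f i = g i * z) :
    (l.map g).prod ∈ S ∧ ∃ z ∈ S, (l.map f).prod = (l.map g).prod * z := by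
  induction l with
  | nil => exact ⟨one_mem _, 1, one_mem _, by simp⟩
  | cons i l ih =>
    obtain ⟨hm, z, hz, e⟩ := ih (fun i hi => hg i (List.mem_cons_of_mem _ hi))
      (fun i hi => hfg i (List.mem_cons_of_mem _ hi))
    obtain ⟨y, hy, e'⟩ := hfg i List.mem_cons_self
    refine ⟨?_, y * z, mul_mem hy hz, ?_⟩
    · rw [List.map_cons, List.prod_cons]
      exact mul_mem (hg i List.mem_cons_self) hm
    · rw [List.map_cons, List.map_cons, List.prod_cons, List.prod_cons, e, e', mul_assoc,
        ← mul_assoc y, (hS y hy _ hm).eq]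
      simp only [mul_assoc]

theorem list_prod_range_telescope {A : Type} [Monoid A] (e : ℕ → A) (τ : ℕ → ℕ) (hτ : Monotone τ)
    (m : ℕ) :
    ((List.range (τ 0)).map e).prod *
      ((List.range m).map fun j => ((List.range (τ (j + 1) - τ j)).map
        fun k => e (τ j + k)).prod).prod = ((List.range (τ m)).map e).prod := by
  induction m with
  | zero => simp
  | succ m ih =>
    rw [List.range_succ, List.map_append, List.prod_append, ← mul_assoc, ih]
    have h1 : τ (m + 1) = τ m + (τ (m + 1) - τ m) := by
      have := hτ (Nat.le_add_right m 1)
      omega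
    conv_rhs => rw [h1, List.range_add, List.map_append, List.prod_append, List.map_map]
    simp [Function.comp_def]

/-- The product `∏_{k < s} ∏_{m=1}^{M} (L_m^p - c_k)`. -/
def levelProdUpTo {K A : Type} [Field K] [Ring A] [Algebra K A] (L : ℕ → A) (p M s : ℕ)
    (c : ℕ → K) : A :=
  ((List.range s).map fun k => levelProd L p M (c k)).prod

/-- The iterated product of the elements `v^+`, without the final factor `u^+`. -/
def vProd {K A : Type} [Field K] [Ring A] [Algebra K A] (T L : ℕ → A) (p : ℕ) (c : ℕ → K)
    (β B τ : ℕ → ℕ) : ℕ → A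
  | 0 => 1
  | j + 1 => (levelProdUpTo L p (β j) (τ j) c * descProd T (β j + B j - 1) ^ B j) *
      vProd T L p c β B τ j

/-- The `j`-th factor of `u^+`. -/
def uFactor {K A : Type} [Field K] [Ring A] [Algebra K A] (L : ℕ → A) (p : ℕ) (c : ℕ → K)
    (B τ : ℕ → ℕ) (j : ℕ) : A :=
  levelProdUpTo L p (B j) (τ (j + 1) - τ j) fun k => c (τ j + k)

namespace HeckeGens
variable {K A : Type} [Field K] [Ring A] [Algebra K A] {q : K} {n : ℕ} {T L : ℕ → A}

theorem commute_of_mem_adjoin (h : HeckeGens q n T L) {x y : A}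
    (hx : x ∈ Algebra.adjoin K {z | ∃ m, 1 ≤ m ∧ m ≤ n ∧ z = L m})
    (hy : y ∈ Algebra.adjoin K {z | ∃ m, 1 ≤ m ∧ m ≤ n ∧ z = L m}) : Commute x y := by
  refine Algebra.commute_of_mem_adjoin_of_forall_mem_commute hy ?_
  rintro _ ⟨m, h1, h2, rfl⟩
  refine (Algebra.commute_of_mem_adjoin_of_forall_mem_commute hx ?_).symm
  rintro _ ⟨m', h1', h2', rfl⟩
  exact h.commute_L_L h1 h2 h1' h2'

end HeckeGens

section levels
variable {K A : Type} [Field K] [Ring A] [Algebra K A] {q : K} {n : ℕ} {T L : ℕ → A}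

theorem L_pow_sub_mem_adjoin (p : ℕ) (c : K) {m : ℕ} (h1 : 1 ≤ m) (h2 : m ≤ n) :
    L m ^ p - algebraMap K A c ∈ Algebra.adjoin K {z | ∃ m, 1 ≤ m ∧ m ≤ n ∧ z = L m} :=
  sub_mem (pow_mem (Algebra.subset_adjoin (s := {z | ∃ m, 1 ≤ m ∧ m ≤ n ∧ z = L m})
    ⟨m, h1, h2, rfl⟩) _) (Subalgebra.algebraMap_mem _ _)

theorem levelProd_mem_adjoin (p : ℕ) (c : K) {M : ℕ} (h : M ≤ n) :
    levelProd L p M c ∈ Algebra.adjoin K {z | ∃ m, 1 ≤ m ∧ m ≤ n ∧ z = L m} := by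
  refine Subalgebra.list_prod_mem _ fun x hx => ?_
  obtain ⟨m, hm, rfl⟩ := List.mem_map.1 hx
  have := List.mem_range.1 hm
  exact L_pow_sub_mem_adjoin p c (by omega) (by omega)

theorem levelProdUpTo_mem_adjoin (p : ℕ) (c : ℕ → K) {M : ℕ} (s : ℕ) (h : M ≤ n) :
    levelProdUpTo L p M s c ∈ Algebra.adjoin K {z | ∃ m, 1 ≤ m ∧ m ≤ n ∧ z = L m} := by
  refine Subalgebra.list_prod_mem _ fun x hx => ?_
  obtain ⟨m, hm, rfl⟩ := List.mem_map.1 hx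
  exact levelProd_mem_adjoin p _ h

namespace HeckeGens

theorem commute_gen_levelProdUpTo (h : HeckeGens q n T L) {i M : ℕ} (p s : ℕ) (c : ℕ → K)
    (hi : i < n) (hM : M ≤ n) (hiM : i ≠ M ∨ i = 0) :
    Commute (T i) (levelProdUpTo L p M s c) := by
  refine Commute.list_prod_right _ _ fun x hx => ?_
  obtain ⟨m, hm, rfl⟩ := List.mem_map.1 hx
  exact h.commute_gen_levelProd p _ hi hM hiM

theorem exists_levelProd_eq (p : ℕ) (c : K) {M : ℕ} (h1 : 1 ≤ M)
    (hM : M ≤ n) :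
    ∃ z ∈ (Algebra.adjoin K {z | ∃ m, 1 ≤ m ∧ m ≤ n ∧ z = L m}).toSubmonoid,
      levelProd L p M c = (L 1 ^ p - algebraMap K A c) * z := by
  induction M, h1 using Nat.le_induction with
  | base => exact ⟨1, one_mem _, by simp [levelProd]⟩
  | succ M h1 ih =>
    obtain ⟨z, hz, e⟩ := ih (by omega)
    exact ⟨_, mul_mem hz (L_pow_sub_mem_adjoin p c (by omega) hM),
      by rw [levelProd_succ, e, mul_assoc]⟩

theorem exists_levelProdUpTo_eq (h : HeckeGens q n T L) (p s : ℕ) (c : ℕ → K) {M : ℕ} (h1 : 1 ≤ M)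
    (hM : M ≤ n) :
    ((List.range s).map fun k => L 1 ^ p - algebraMap K A (c k)).prod ∈
      (Algebra.adjoin K {z | ∃ m, 1 ≤ m ∧ m ≤ n ∧ z = L m}).toSubmonoid ∧
    ∃ z ∈ (Algebra.adjoin K {z | ∃ m, 1 ≤ m ∧ m ≤ n ∧ z = L m}).toSubmonoid,
      levelProdUpTo L p M s c =
        ((List.range s).map fun k => L 1 ^ p - algebraMap K A (c k)).prod * z :=
  exists_list_prod_factor (fun x hx y hy => h.commute_of_mem_adjoin hx hy) _ _ _
    (fun i _ => L_pow_sub_mem_adjoin p _ le_rfl (by omega))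
    fun i _ => exists_levelProd_eq p _ h1 hM

theorem exists_genUnits_vProd (h : HeckeGens q n T L) (hT0 : IsUnit (T 0)) (hn : 1 ≤ n) (p : ℕ)
    (c : ℕ → K) {β B τ : ℕ → ℕ} {m : ℕ} (hB : ∀ j < m, B (j + 1) = B j + β j) (hBm : B m ≤ n)
    (hτ : Monotone τ)
    (hcyc : ((List.range (τ m)).map fun k => T 0 ^ p - algebraMap K A (c k)).prod = 0)
    {j : ℕ} (hj : j ≤ m) :
    ∃ g ∈ genUnits K T (B j),
      vProd T L p c β B τ j * T 0 * ((List.range m).map (uFactor L p c B τ)).prod =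
        g * (vProd T L p c β B τ j * ((List.range m).map (uFactor L p c B τ)).prod) := by
  have hBmono : ∀ i k, i ≤ k → k ≤ m → B i ≤ B k := by
    intro i k hik
    induction k, hik using Nat.le_induction with
    | base => intro _; exact le_rfl
    | succ k hik ih =>
      intro hk
      have := hB k (by omega)
      have := ih (by omega)
      omega
  have hBn : ∀ i ≤ m, B i ≤ n := fun i hi => (hBmono i m hi le_rfl).trans hBm
  have hβn : ∀ i < m, β i ≤ n := fun i hi => by
    have := hB i hi
    have := hBn (i + 1) hi
    omega
  induction j with
  | zero =>
    obtain ⟨g, hg, e⟩ := h.exists_genUnits_eq_gen hT0 (i := 0) (c := B 0) hn (Or.inl rfl)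
    exact ⟨g, hg, by simp [vProd, e]⟩
  | succ j ih =>
    obtain ⟨g, hg, e⟩ := ih (by omega)
    set R := ((List.range j).map (uFactor L p c B τ)).prod with hR
    set W := ((List.range (m - j)).map fun i => uFactor L p c B τ (j + i)).prod with hWdef
    have hu : ((List.range m).map (uFactor L p c B τ)).prod = R * W := by
      conv_lhs => rw [show m = j + (m - j) by omega, List.range_add, List.map_append,
        List.prod_append, List.map_map]
      rfl
    have hWmem : W ∈ Algebra.adjoin K {z | ∃ m, 1 ≤ m ∧ m ≤ n ∧ z = L m} := by
      refine Subalgebra.list_prod_mem _ fun x hx => ?_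
      obtain ⟨i, hi, rfl⟩ := List.mem_map.1 hx
      have := List.mem_range.1 hi
      exact levelProdUpTo_mem_adjoin p _ _ (hBn _ (by omega))
    have hRmem : R ∈ Algebra.adjoin K {z | ∃ m, 1 ≤ m ∧ m ≤ n ∧ z = L m} := by
      refine Subalgebra.list_prod_mem _ fun x hx => ?_
      obtain ⟨i, hi, rfl⟩ := List.mem_map.1 hx
      have := List.mem_range.1 hi
      exact levelProdUpTo_mem_adjoin p _ _ (hBn _ (by omega))
    have hWT : ∀ i, (i = 0 ∨ i < B j) → Commute W (T i) := by
      intro i hi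
      have := hBn j (by omega)
      refine (Commute.list_prod_right _ _ fun x hx => ?_).symm
      obtain ⟨k, hk, rfl⟩ := List.mem_map.1 hx
      have := List.mem_range.1 hk
      have := hBmono j (j + k) (by omega) (by omega)
      exact h.commute_gen_levelProdUpTo p _ _ (by omega) (hBn _ (by omega)) (by omega)
    have hWV : ∀ i ≤ j, Commute W (vProd T L p c β B τ i) := by
      intro i hi
      induction i with
      | zero => exact Commute.one_right _
      | succ i ihi =>
        refine Commute.mul_right (Commute.mul_right ?_ (Commute.pow_right ?_ _)) (ihi (by omega))
        · exact h.commute_of_mem_adjoin hWmem (levelProdUpTo_mem_adjoin p _ _ (hβn _ (by omega)))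
        · refine BraidGens.commute_descProd_of_forall fun k h1 h2 => hWT k ?_
          have := hB i (by omega)
          have := hBmono (i + 1) j (by omega) (by omega)
          omega
    have hBj := hB j hj
    have hBj1 := hBn (j + 1) hj
    have hv : ∀ i, (i = 0 ∨ i < B j) → ∃ g ∈ genUnits K T (β j + B j),
        (levelProdUpTo L p (β j) (τ j) c * descProd T (β j + B j - 1) ^ B j) * T i * W =
          g * (levelProdUpTo L p (β j) (τ j) c * descProd T (β j + B j - 1) ^ B j) * W := by
      intro i hi
      refine h.exists_genUnits_mul_descProd_pow hT0 hn (by omega)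
        (h.commute_gen_levelProdUpTo p _ _ (by omega) (hβn _ (by omega)) (Or.inr rfl)).symm
        (fun i hi hia => (h.commute_gen_levelProdUpTo p _ _ hi (hβn _ (by omega))
          (Or.inl hia)).symm)
        (fun m h1 h2 => h.commute_of_mem_adjoin (levelProdUpTo_mem_adjoin p _ _ (hβn _ (by omega)))
          (Algebra.subset_adjoin ⟨m, h1, h2, rfl⟩)) hWT ?_ hi
      intro ha hc
      obtain ⟨hU, W', hW', eW⟩ := exists_list_prod_factor
        (fun x hx y hy => h.commute_of_mem_adjoin hx hy) (List.range (m - j))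
        (fun i => uFactor L p c B τ (j + i))
        (fun i => ((List.range (τ (j + i + 1) - τ (j + i))).map
          fun k => L 1 ^ p - algebraMap K A (c (τ (j + i) + k))).prod)
        (fun i hi => by
          have := List.mem_range.1 hi
          have := hBmono j (j + i) (by omega) (by omega)
          exact (h.exists_levelProdUpTo_eq p _ _ (M := B (j + i)) (by omega)
            (hBn _ (by omega))).1)
        (fun i hi => by
          have := List.mem_range.1 hi
          have := hBmono j (j + i) (by omega) (by omega)
          exact (h.exists_levelProdUpTo_eq p _ _ (M := B (j + i)) (by omega)
            (hBn _ (by omega))).2)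
      obtain ⟨hu1, z, hz, ez⟩ := h.exists_levelProdUpTo_eq p (τ j) c ha (hβn j (by omega))
      refine ⟨_, W', eW, ?_, ?_, ?_⟩
      · rw [ez, (h.commute_of_mem_adjoin hu1 hz).eq, mul_assoc]
        have := list_prod_range_telescope (fun k => L 1 ^ p - algebraMap K A (c k))
          (fun i => τ (j + i)) (fun a b hab => hτ (by omega)) (m - j)
        simp only [add_zero] at this
        rw [show j + (m - j) = m by omega] at this
        simp only [← add_assoc] at this
        rw [this, h.L_one, hcyc, mul_zero]
      · intro m h1 h2
        exact h.commute_of_mem_adjoin hU (Algebra.subset_adjoin ⟨m, h1, h2, rfl⟩)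
      · intro i h1 h2
        refine (Commute.list_prod_right _ _ fun x hx => ?_).symm
        obtain ⟨k, hk, rfl⟩ := List.mem_map.1 hx
        refine Commute.list_prod_right _ _ fun x hx => ?_
        obtain ⟨k, hk, rfl⟩ := List.mem_map.1 hx
        exact commute_L_pow_sub p _ (h.commute_gen_L_of_lt le_rfl (by omega) h2)
    obtain ⟨g', hg', e'⟩ := exists_genUnits_mul_eq hWT hv hg
    refine ⟨g', by rw [hBj, add_comm]; exact hg', ?_⟩
    rw [vProd]
    set v := levelProdUpTo L p (β j) (τ j) c * descProd T (β j + B j - 1) ^ B j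
    set V := vProd T L p c β B τ j
    have cRW := (h.commute_of_mem_adjoin hRmem hWmem).eq
    rw [hu, cRW] at e ⊢
    have cWV : W * V = V * W := (hWV j le_rfl).eq
    calc v * V * T 0 * (W * R) = v * (V * T 0 * (W * R)) := by simp only [mul_assoc]
      _ = v * g * (V * W) * R := by rw [e]; simp only [mul_assoc]
      _ = (v * g * W) * V * R := by rw [← cWV]; simp only [mul_assoc]
      _ = g' * v * (W * V) * R := by rw [e']; simp only [mul_assoc]
      _ = _ := by rw [cWV]; simp only [mul_assoc]

end HeckeGens
end levels

section invertibility
variable {K A : Type} [Field K] [Ring A] [Algebra K A]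

theorem exists_list_prod_sub_eq (x : A) (l : List K) (hl : ∀ c ∈ l, c ≠ 0) :
    ∃ y ∈ Algebra.adjoin K {x}, ∃ d : K, d ≠ 0 ∧
      (l.map fun c => x - algebraMap K A c).prod = y * x + algebraMap K A d := by
  induction l with
  | nil => exact ⟨0, zero_mem _, 1, one_ne_zero, by simp⟩
  | cons c l ih =>
    obtain ⟨y, hy, d, hd, e⟩ := ih fun c hc => hl c (List.mem_cons_of_mem _ hc)
    have hx : x ∈ Algebra.adjoin K {x} := Algebra.subset_adjoin rfl
    refine ⟨(x - algebraMap K A c) * y + algebraMap K A d,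
      add_mem (mul_mem (sub_mem hx (Subalgebra.algebraMap_mem _ _)) hy)
        (Subalgebra.algebraMap_mem _ _), -(c * d),
      neg_ne_zero.2 (mul_ne_zero (hl c List.mem_cons_self) hd), ?_⟩
    rw [List.map_cons, List.prod_cons, e, mul_add, add_mul, mul_assoc, sub_mul _ _ (algebraMap K A d),
      ← Algebra.commutes d x, map_neg, map_mul]
    abel

theorem exists_unit_of_list_prod_eq_zero {p : ℕ} (hp : 0 < p) (x : A) (l : List K)
    (hl : ∀ c ∈ l, c ≠ 0) (h : (l.map fun c => x ^ p - algebraMap K A c).prod = 0) :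
    ∃ t : Aˣ, (t : A) = x ∧ ((t⁻¹ : Aˣ) : A) ^ p ∈ Algebra.adjoin K {x ^ p} := by
  obtain ⟨y, hy, d, hd, e⟩ := exists_list_prod_sub_eq (x ^ p) l hl
  have e1 : ((-d)⁻¹ • y) * x ^ p = 1 := by
    rw [h] at e
    rw [smul_mul_assoc, ← neg_eq_of_add_eq_zero_left e.symm, Algebra.algebraMap_eq_smul_one,
      ← neg_smul, smul_smul, inv_mul_cancel₀ (neg_ne_zero.2 hd), one_smul]
  have hz : (-d)⁻¹ • y ∈ Algebra.adjoin K {x ^ p} := Subalgebra.smul_mem _ hy _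
  have hc : Commute (x ^ p) ((-d)⁻¹ • y) :=
    Algebra.commute_of_mem_adjoin_of_forall_mem_commute hz (by rintro _ rfl; exact Commute.refl _)
  have hu : IsUnit (x ^ p) := ⟨⟨_, _, hc.eq.trans e1, e1⟩, rfl⟩
  obtain ⟨t, rfl⟩ := (isUnit_pow_iff hp.ne').1 hu
  refine ⟨t, rfl, ?_⟩
  have : ((t⁻¹ : Aˣ) : A) ^ p = (-d)⁻¹ • y := by
    calc ((t⁻¹ : Aˣ) : A) ^ p = ((-d)⁻¹ • y) * (t : A) ^ p * ((t⁻¹ : Aˣ) : A) ^ p := by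
          rw [e1, one_mul]
      _ = _ := by
          rw [mul_assoc, ← Units.val_pow_eq_pow_val, ← Units.val_pow_eq_pow_val, inv_pow,
            Units.mul_inv, mul_one]
  rw [this]
  exact hz

end invertibility

theorem mem_span_mul_pow {K A : Type} [Field K] [Ring A] [Algebra K A] {B : Subalgebra K A}
    {t : Aˣ} {s : Set A} (hs : Algebra.adjoin K s = ⊤) (hsB : ∀ x ∈ s, x ∈ B ∨ x = t)
    (hB : ∀ b ∈ B, t * b * ((t⁻¹ : Aˣ) : A) ∈ B) (a : A) :
    a ∈ Submodule.span K {x | ∃ b ∈ B, ∃ k : ℕ, x = b * (t : A) ^ k} := by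
  set M := Submodule.span K {x | ∃ b ∈ B, ∃ k : ℕ, x = b * (t : A) ^ k}
  have key : ∀ x ∈ s, ∀ m ∈ M, x * m ∈ M := by
    intro x hx m hm
    induction hm using Submodule.span_induction with
    | mem m hm =>
      obtain ⟨b, hb, k, rfl⟩ := hm
      refine Submodule.subset_span ?_
      rcases hsB x hx with h | rfl
      · exact ⟨x * b, mul_mem h hb, k, (mul_assoc _ _ _).symm⟩
      · refine ⟨_, hB b hb, k + 1, ?_⟩
        rw [pow_succ', mul_assoc _ _ ((t : A) * _), ← mul_assoc _ (t : A), Units.inv_mul, one_mul,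
          mul_assoc]
    | zero => rw [mul_zero]; exact zero_mem _
    | add m m' _ _ h h' => rw [mul_add]; exact add_mem h h'
    | smul c m _ h => rw [mul_smul_comm]; exact M.smul_mem c h
  have hall : ∀ x ∈ Algebra.adjoin K s, ∀ m ∈ M, x * m ∈ M := by
    intro x hx
    induction hx using Algebra.adjoin_induction with
    | mem x hx => exact key x hx
    | algebraMap c => intro m hm; rw [← Algebra.smul_def]; exact M.smul_mem c hm
    | add x y _ _ h h' => intro m hm; rw [add_mul]; exact add_mem (h m hm) (h' m hm)
    | mul x y _ _ h h' => intro m hm; rw [mul_assoc]; exact h _ (h' m hm)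
  have h1 : (1 : A) ∈ M := Submodule.subset_span ⟨1, one_mem _, 0, by simp⟩
  simpa using hall a (hs ▸ Algebra.mem_top) 1 h1

theorem conj_adjoin_mem {K A : Type} [Field K] [Ring A] [Algebra K A] {s : Set A} {t : Aˣ}
    (hs : ∀ x ∈ s, ((t⁻¹ : Aˣ) : A) * x * t ∈ Algebra.adjoin K s) {b : A}
    (hb : b ∈ Algebra.adjoin K s) : ((t⁻¹ : Aˣ) : A) * b * t ∈ Algebra.adjoin K s := by
  induction hb using Algebra.adjoin_induction with
  | mem x hx => exact hs x hx
  | algebraMap c =>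
    rw [← Algebra.commutes, mul_assoc, Units.inv_mul, mul_one]
    exact Subalgebra.algebraMap_mem _ _
  | add x y _ _ h h' => rw [mul_add, add_mul]; exact add_mem h h'
  | mul x y _ _ h h' =>
    have : ((t⁻¹ : Aˣ) : A) * (x * y) * t =
        (((t⁻¹ : Aˣ) : A) * x * t) * (((t⁻¹ : Aˣ) : A) * y * t) := by
      simp only [mul_assoc, Units.mul_inv_cancel_left]
    rw [this]
    exact mul_mem h h'

theorem conj_mem_of_conj_inv_mem {K A : Type} [Field K] [Ring A] [Algebra K A] {B : Subalgebra K A}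
    {t : Aˣ} {p : ℕ} (hp : 0 < p) (hB : ∀ b ∈ B, ((t⁻¹ : Aˣ) : A) * b * t ∈ B)
    (h1 : (t : A) ^ p ∈ B) (h2 : ((t⁻¹ : Aˣ) : A) ^ p ∈ B) {b : A} (hb : b ∈ B) :
    t * b * ((t⁻¹ : Aˣ) : A) ∈ B := by
  have hk : ∀ k : ℕ, ((t⁻¹ : Aˣ) : A) ^ k * b * (t : A) ^ k ∈ B := by
    intro k
    induction k with
    | zero => simpa using hb
    | succ k ih =>
      have := hB _ ih
      rw [pow_succ', pow_succ]
      simpa only [mul_assoc] using this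
  obtain ⟨k, rfl⟩ : ∃ k, p = k + 1 := ⟨p - 1, by omega⟩
  have := mul_mem (mul_mem h1 (hk k)) h2
  have e : (t : A) ^ (k + 1) * (((t⁻¹ : Aˣ) : A) ^ k * b * (t : A) ^ k) *
      ((t⁻¹ : Aˣ) : A) ^ (k + 1) = t * b * ((t⁻¹ : Aˣ) : A) := by
    have e1 : (t : A) ^ k * ((t⁻¹ : Aˣ) : A) ^ k = 1 := by
      rw [← Units.val_pow_eq_pow_val, ← Units.val_pow_eq_pow_val, inv_pow, Units.mul_inv]
    rw [pow_succ' (t : A), pow_succ ((t⁻¹ : Aˣ) : A)]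
    calc _ = (t : A) * ((t : A) ^ k * ((t⁻¹ : Aˣ) : A) ^ k) * b *
          ((t : A) ^ k * ((t⁻¹ : Aˣ) : A) ^ k) * ((t⁻¹ : Aˣ) : A) := by simp only [mul_assoc]
      _ = _ := by rw [e1, mul_one, mul_one]
  rwa [e] at this

namespace HeckeGens
variable {K A : Type} [Field K] [Ring A] [Algebra K A] {q : K} {n : ℕ} {T L : ℕ → A}

theorem isCrossed (h : HeckeGens q n T L) (hn : 1 < n) {p : ℕ} (hp : 0 < p) {ε : K}
    (hε : ε ^ p = 1) {σ : A →ₐ[K] A} (hσ0 : σ (T 0) = ε • T 0)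
    (hσ : ∀ i, 1 ≤ i → i < n → σ (T i) = T i) {t : Aˣ} (ht : (t : A) = T 0)
    (hgen : Algebra.adjoin K {x | ∃ i < n, x = T i} = ⊤)
    (htp : ((t⁻¹ : Aˣ) : A) ^ p ∈ Algebra.adjoin K {T 0 ^ p}) :
    IsCrossed p ε σ (Algebra.adjoin K ({T 0 ^ p, ((t⁻¹ : Aˣ) : A) * T 1 * T 0} ∪
      {x | ∃ i : ℕ, 1 ≤ i ∧ i < n ∧ x = T i})) t := by
  have hε0 : ε ≠ 0 := by
    rintro rfl
    rw [zero_pow hp.ne'] at hε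
    exact zero_ne_one hε
  set G : Set A := {T 0 ^ p, ((t⁻¹ : Aˣ) : A) * T 1 * T 0} ∪
    {x | ∃ i : ℕ, 1 ≤ i ∧ i < n ∧ x = T i} with hG
  have hGp : T 0 ^ p ∈ Algebra.adjoin K G := Algebra.subset_adjoin (Or.inl (Or.inl rfl))
  have hGs : ((t⁻¹ : Aˣ) : A) * T 1 * T 0 ∈ Algebra.adjoin K G :=
    Algebra.subset_adjoin (Or.inl (Or.inr rfl))
  have hGT : ∀ i, 1 ≤ i → i < n → T i ∈ Algebra.adjoin K G := fun i h1 h2 =>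
    Algebra.subset_adjoin (Or.inr ⟨i, h1, h2, rfl⟩)
  have hpow : (t : A) ^ p ∈ Algebra.adjoin K G := by rw [ht]; exact hGp
  have hinv : ((t⁻¹ : Aˣ) : A) ^ p ∈ Algebra.adjoin K G :=
    Algebra.adjoin_le (by rintro _ rfl; exact hGp) htp
  have hconj : ∀ b ∈ Algebra.adjoin K G, ((t⁻¹ : Aˣ) : A) * b * t ∈ Algebra.adjoin K G := by
    intro b hb
    refine conj_adjoin_mem ?_ hb
    rintro x ((rfl | rfl) | ⟨i, h1, h2, rfl⟩)
    · have : ((t⁻¹ : Aˣ) : A) * T 0 ^ p * t = T 0 ^ p := by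
        rw [← ht, mul_assoc, ← pow_succ, pow_succ', ← mul_assoc, Units.inv_mul, one_mul]
      rw [this]
      exact hGp
    · have hb := h.braid01 hn
      rw [← ht] at hb hGs ⊢
      have e1 : T 1 * (q⁻¹ • (T 1 - (q - 1) • 1)) = 1 := by
        rw [mul_smul_comm, mul_sub, h.gen_mul_self le_rfl hn, mul_smul_comm, mul_one,
          add_sub_cancel_left, smul_smul, inv_mul_cancel₀ h.q_ne, one_smul]
      set z := q⁻¹ • (T 1 - (q - 1) • 1)
      have hz : ((t⁻¹ : Aˣ) : A) * z * t ∈ Algebra.adjoin K G := by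
        have : ((t⁻¹ : Aˣ) : A) * z * t =
            q⁻¹ • (((t⁻¹ : Aˣ) : A) * T 1 * t - (q - 1) • 1) := by
          simp only [z, mul_smul_comm, smul_mul_assoc, mul_sub, sub_mul, mul_one, Units.inv_mul]
        rw [this]
        exact Subalgebra.smul_mem _ (sub_mem hGs (Subalgebra.smul_mem _ (one_mem _) _)) _
      have e2 : ((t⁻¹ : Aˣ) : A) * (((t⁻¹ : Aˣ) : A) * T 1 * t) * t =
          (((t⁻¹ : Aˣ) : A) * T 1 * t) * T 1 * (((t⁻¹ : Aˣ) : A) * z * t) := by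
        calc ((t⁻¹ : Aˣ) : A) * (((t⁻¹ : Aˣ) : A) * T 1 * t) * t
            = ((t⁻¹ : Aˣ) : A) * (((t⁻¹ : Aˣ) : A) * T 1 * t) * (T 1 * z) * t := by
              rw [e1, mul_one]
          _ = ((t⁻¹ : Aˣ) : A) * ((t⁻¹ : Aˣ) : A) * (T 1 * t * T 1 * t) *
              (((t⁻¹ : Aˣ) : A) * z * t) := by
              simp only [mul_assoc, Units.mul_inv_cancel_left]
          _ = _ := by
              rw [← hb]
              simp only [mul_assoc, Units.inv_mul_cancel_left]
      rw [e2]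
      exact mul_mem (mul_mem hGs (hGT 1 le_rfl hn)) hz
    · rcases h1.eq_or_lt with rfl | h1
      · rw [ht]
        exact hGs
      · have hc : T 0 * T i = T i * T 0 := (h.comm 0 i (by omega) h2).eq
        rw [mul_assoc, ht, ← hc, ← ht, Units.inv_mul_cancel_left]
        exact hGT i (by omega) h2
  have hconj' : ∀ b ∈ Algebra.adjoin K G, t * b * ((t⁻¹ : Aˣ) : A) ∈ Algebra.adjoin K G :=
    fun b hb => conj_mem_of_conj_inv_mem hp hconj hpow hinv hb
  refine ⟨by rw [ht, hσ0], ?_, hconj', hconj, hpow, hinv, ?_⟩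
  · intro b hb
    induction hb using Algebra.adjoin_induction with
    | mem x hx =>
      rcases hx with (rfl | rfl) | ⟨i, h1, h2, rfl⟩
      · rw [map_pow, hσ0, smul_pow, hε, one_smul]
      · have e : (t : A) * (((t⁻¹ : Aˣ) : A) * T 1 * T 0) = T 1 * T 0 := by
          rw [mul_assoc, Units.mul_inv_cancel_left]
        have e' := congrArg σ e
        rw [map_mul σ (t : A), ht, map_mul σ (T 1), hσ0, hσ 1 le_rfl hn, mul_smul_comm,
          smul_mul_assoc] at e'
        have e'' := smul_right_injective A hε0 e'
        rw [← e, ← ht] at e''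
        rw [← ht]
        exact t.isUnit.mul_left_cancel e''
      · exact hσ i h1 h2
    | algebraMap c => exact AlgHom.commutes σ c
    | add x y _ _ hx hy => rw [map_add, hx, hy]
    | mul x y _ _ hx hy => rw [map_mul, hx, hy]
  · refine mem_span_mul_pow hgen ?_ hconj'
    rintro x ⟨i, hi, rfl⟩
    rcases Nat.eq_zero_or_pos i with rfl | h0
    · exact Or.inr ht.symm
    · exact Or.inl (hGT i h0 hi)

end HeckeGens

section sigmaFixed
variable {K A : Type} [Field K] [Ring A] [Algebra K A] {T L : ℕ → A} {σ : A →ₐ[K] A} {p : ℕ}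

theorem map_levelProdUpTo_of_fixed (hL : ∀ m, σ (L (m + 1) ^ p) = L (m + 1) ^ p) (M s : ℕ)
    (c : ℕ → K) : σ (levelProdUpTo L p M s c) = levelProdUpTo L p M s c := by
  simp only [levelProdUpTo, levelProd, map_list_prod, List.map_map, Function.comp_def, map_sub, hL,
    AlgHom.commutes]

theorem map_descProd_of_fixed (hT : ∀ i, 1 ≤ i → σ (T i) = T i) (k : ℕ) :
    σ (descProd T k) = descProd T k := by
  induction k with
  | zero => exact map_one σ
  | succ k ih => rw [descProd, map_mul, ih, hT _ (by omega)]

theorem map_vProd_of_fixed (hT : ∀ i, 1 ≤ i → σ (T i) = T i)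
    (hL : ∀ m, σ (L (m + 1) ^ p) = L (m + 1) ^ p) (c : ℕ → K) (β B τ : ℕ → ℕ) (m : ℕ) :
    σ (vProd T L p c β B τ m) = vProd T L p c β B τ m := by
  induction m with
  | zero => exact map_one σ
  | succ m ih =>
    rw [vProd, map_mul, ih, map_mul, map_levelProdUpTo_of_fixed hL, map_pow,
      map_descProd_of_fixed hT]

theorem map_prod_uFactor_of_fixed (hL : ∀ m, σ (L (m + 1) ^ p) = L (m + 1) ^ p) (c : ℕ → K)
    (B τ : ℕ → ℕ) (m : ℕ) :
    σ ((List.range m).map (uFactor L p c B τ)).prod =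
      ((List.range m).map (uFactor L p c B τ)).prod := by
  simp only [map_list_prod, List.map_map, Function.comp_def, uFactor, map_levelProdUpTo_of_fixed hL]
  rfl

end sigmaFixed

section presentation
variable {K : Type} [Field K] {q : K} {p t n : ℕ} {Q : Fin t → K}

theorem Tg_of_le {i : ℕ} (hi : n ≤ i) : Tg K q p Q n i = 1 :=
  dif_neg (by omega)

/-- The quotient map from the free algebra. -/
def akMk : FreeAlgebra K (Fin n) →ₐ[K] AK K q p Q n := RingQuot.mkAlgHom K (AKRel K q p Q n)

theorem akMk_eq_of_rel {x y : FreeAlgebra K (Fin n)} (h : AKRel K q p Q n x y) :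
    (akMk x : AK K q p Q n) = akMk y :=
  RingQuot.mkAlgHom_rel K h

theorem akMk_ι {i : ℕ} (hi : i < n) :
    (akMk (FreeAlgebra.ι K ⟨i, hi⟩) : AK K q p Q n) = Tg K q p Q n i :=
  (dif_pos hi : Tg K q p Q n i = akMk (FreeAlgebra.ι K ⟨i, hi⟩)).symm

theorem heckeGens_AK (hq : q ≠ 0) : HeckeGens q n (Tg K q p Q n) (Lm K q p Q n) where
  braid i h1 h2 := by
    simpa only [map_mul, akMk_ι] using akMk_eq_of_rel (AKRel.braid (Q := Q) (p := p) (q := q) i h1 h2)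
  comm i j h1 h2 := by
    show _ = _
    simpa only [map_mul, akMk_ι] using akMk_eq_of_rel (AKRel.comm (Q := Q) (p := p) (q := q) i j h1 h2)
  q_ne := hq
  braid01 h1 := by
    simpa only [map_mul, akMk_ι] using akMk_eq_of_rel (AKRel.braid01 (Q := Q) (p := p) (q := q) h1)
  quad i h1 h2 := by
    simpa only [map_mul, map_add, map_sub, map_one, map_zero, AlgHom.commutes, akMk_ι] using
      akMk_eq_of_rel (AKRel.quad (Q := Q) (p := p) (q := q) i h1 h2)
  L_one := rfl
  L_succ k h1 _ := by
    obtain ⟨k, rfl⟩ : ∃ j, k = j + 1 := ⟨k - 1, by omega⟩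
    rw [← Ring.inverse_eq_inv]
    rfl

theorem cyclotomic_AK (hn : 0 < n) :
    ((List.range t).map fun k =>
      Tg K q p Q n 0 ^ p - algebraMap K (AK K q p Q n) (Qat K Q (k + 1) ^ p)).prod = 0 := by
  have h := akMk_eq_of_rel (AKRel.cyclo (Q := Q) (p := p) (q := q) hn)
  simp only [map_list_prod, List.map_map, Function.comp_def, map_sub, map_pow, map_zero,
    AlgHom.commutes, akMk_ι] at h
  rw [← h, ← List.map_coe_finRange_eq_range, List.map_map]
  congr 1
  refine List.map_congr_left fun k _ => ?_
  simp [Qat]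

theorem adjoin_Tg : Algebra.adjoin K {x | ∃ i < n, x = Tg K q p Q n i} = ⊤ := by
  have hs : Function.Surjective (akMk : FreeAlgebra K (Fin n) →ₐ[K] AK K q p Q n) :=
    RingQuot.mkAlgHom_surjective K _
  rw [← (AlgHom.range_eq_top _).2 hs, ← Algebra.map_top, ← FreeAlgebra.adjoin_range_ι,
    AlgHom.map_adjoin]
  congr 1
  ext x
  constructor
  · rintro ⟨i, hi, rfl⟩
    exact ⟨_, ⟨⟨i, hi⟩, rfl⟩, akMk_ι hi⟩
  · rintro ⟨_, ⟨i, rfl⟩, rfl⟩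
    exact ⟨i, i.2, akMk_ι i.2⟩

theorem exists_algHom_AK {B : Type} [Ring B] [Algebra K B] (f : ℕ → B)
    (hcyc : 0 < n → ((List.finRange t).map fun k => f 0 ^ p - algebraMap K B (Q k ^ p)).prod = 0)
    (hbraid01 : 1 < n → f 0 * f 1 * f 0 * f 1 = f 1 * f 0 * f 1 * f 0)
    (hquad : ∀ i, 1 ≤ i → i < n → (f i + 1) * (f i - algebraMap K B q) = 0)
    (hbraid : ∀ i, 1 ≤ i → i + 1 < n → f i * f (i + 1) * f i = f (i + 1) * f i * f (i + 1))
    (hcomm : ∀ i j, i + 1 < j → j < n → f i * f j = f j * f i) :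
    ∃ φ : AK K q p Q n →ₐ[K] B, ∀ i < n, φ (Tg K q p Q n i) = f i := by
  let F : FreeAlgebra K (Fin n) →ₐ[K] B := FreeAlgebra.lift K fun i => f i
  have hF : ∀ i : Fin n, F (FreeAlgebra.ι K i) = f i := fun i => FreeAlgebra.lift_ι_apply _ _
  have hrel : ∀ ⦃x y⦄, AKRel K q p Q n x y → F x = F y := by
    intro x y h
    cases h with
    | cyclo h0 =>
      simpa only [map_list_prod, List.map_map, Function.comp_def, map_sub, map_pow, map_zero,
        AlgHom.commutes, hF] using hcyc h0
    | braid01 h1 => simpa only [map_mul, hF] using hbraid01 h1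
    | quad i h1 h2 =>
      simpa only [map_mul, map_add, map_sub, map_one, map_zero, AlgHom.commutes, hF] using
        hquad i h1 h2
    | braid i h1 h2 => simpa only [map_mul, hF] using hbraid i h1 h2
    | comm i j h1 h2 => simpa only [map_mul, hF] using hcomm i j h1 h2
  refine ⟨RingQuot.liftAlgHom K ⟨F, hrel⟩, fun i hi => ?_⟩
  rw [← akMk_ι hi]
  exact (RingQuot.liftAlgHom_mkAlgHom_apply K F hrel _).trans (hF _)

theorem exists_sigma_AK (hq : q ≠ 0) {ε : K} (hε : ε ^ p = 1) (hn : 0 < n) :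
    ∃ σ : AK K q p Q n →ₐ[K] AK K q p Q n, σ (Tg K q p Q n 0) = ε • Tg K q p Q n 0 ∧
      (∀ i, 1 ≤ i → σ (Tg K q p Q n i) = Tg K q p Q n i) ∧
      ∀ m, σ (Lm K q p Q n (m + 1)) = ε • Lm K q p Q n (m + 1) := by
  have h : HeckeGens q n (Tg K q p Q n) (Lm K q p Q n) := heckeGens_AK hq
  obtain ⟨σ, hσ⟩ := exists_algHom_AK (Q := Q) (q := q) (p := p) (n := n)
    (fun i => if i = 0 then ε • Tg K q p Q n 0 else Tg K q p Q n i)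
    (fun _ => by
      have h := akMk_eq_of_rel (AKRel.cyclo (Q := Q) (p := p) (q := q) hn)
      simpa only [map_list_prod, List.map_map, Function.comp_def, map_sub, map_pow, map_zero,
        AlgHom.commutes, akMk_ι, if_true, smul_pow, hε, one_smul] using h)
    (fun h1 => by
      simp only [if_true, one_ne_zero, if_false, smul_mul_assoc, mul_smul_comm, h.braid01 h1])
    (fun i h1 h2 => by simpa only [if_neg (show i ≠ 0 by omega)] using h.quad i h1 h2)
    (fun i h1 h2 => by
      simpa only [if_neg (show i ≠ 0 by omega), if_neg (show i + 1 ≠ 0 by omega)] using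
        h.braid i h1 h2)
    (fun i j h1 h2 => by
      have hc := (h.comm i j h1 h2).eq
      rw [if_neg (show j ≠ 0 by omega)]
      split_ifs with hi
      · subst hi
        rw [smul_mul_assoc, mul_smul_comm, hc]
      · exact hc)
  have h0 : σ (Tg K q p Q n 0) = ε • Tg K q p Q n 0 := by rw [hσ 0 hn, if_pos rfl]
  have h1 : ∀ i, 1 ≤ i → σ (Tg K q p Q n i) = Tg K q p Q n i := by
    intro i hi
    rcases Nat.lt_or_ge i n with hin | hin
    · rw [hσ i hin, if_neg (by omega)]
    · rw [Tg_of_le hin, map_one]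
  refine ⟨σ, h0, h1, fun m => ?_⟩
  induction m with
  | zero => exact h0
  | succ m ih =>
    rw [Lm, map_smul, map_mul, map_mul, ih, h1 _ (by omega), mul_smul_comm, smul_mul_assoc,
      smul_comm]

theorem Tword_wabWord (a c : ℕ) :
    Tword K q p Q n (wabWord a c) = descProd (Tg K q p Q n) (a + c - 1) ^ c := by
  have h : ∀ k, (((List.range' 1 k).reverse).map (Tg K q p Q n)).prod =
      descProd (Tg K q p Q n) k := by
    intro k
    induction k with
    | zero => rfl
    | succ k ih =>
      rw [List.range'_concat, List.reverse_append, List.map_append, List.prod_append, ih]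
      simp [descProd, add_comm]
  simp only [Tword, wabWord, List.map_flatten, List.prod_flatten, List.map_replicate,
    List.prod_replicate, h]

theorem vplus_eq (a c s : ℕ) :
    vplus K q p Q n a c s = levelProdUpTo (Lm K q p Q n) p a s (fun k => Qat K Q (k + 1) ^ p) *
      descProd (Tg K q p Q n) (a + c - 1) ^ c := by
  rw [vplus, Tword_wabWord]
  rfl

variable {κ : ℕ} {t_ : Fin κ → ℕ} {b : Fin κ → ℕ}

theorem tsum_mono : Monotone (tsum κ t_) := fun _ _ h =>
  Finset.sum_le_sum_of_subset (Finset.Icc_subset_Icc_right h)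

theorem bsum_succ (j : ℕ) : bsum κ b (j + 1) = bsum κ b j + bat κ b (j + 1) :=
  Finset.sum_Icc_succ_top (by omega) _

theorem vbMinus_eq : vbMinus K q p Q n κ t_ b =
    vProd (Tg K q p Q n) (Lm K q p Q n) p (fun k => Qat K Q (k + 1) ^ p)
      (fun j => bat κ b (j + 2)) (fun j => bsum κ b (j + 1)) (fun j => tsum κ t_ (j + 1))
      (κ - 1) := by
  have h : ∀ (m k : ℕ), k = m + 1 → ((List.range m).map fun idx =>
      vplus K q p Q n (bat κ b (k - idx)) (bsum κ b (k - idx - 1)) (tsum κ t_ (k - idx - 1))).prod =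
      vProd (Tg K q p Q n) (Lm K q p Q n) p (fun k => Qat K Q (k + 1) ^ p)
        (fun j => bat κ b (j + 2)) (fun j => bsum κ b (j + 1)) (fun j => tsum κ t_ (j + 1)) m := by
    intro m
    induction m with
    | zero => intros; rfl
    | succ m ih =>
      rintro _ rfl
      rw [List.range_succ_eq_map, List.map_cons, List.prod_cons, List.map_map, vProd, ← ih _ rfl,
        vplus_eq]
      simp only [Function.comp_def, Nat.succ_eq_add_one, Nat.add_sub_add_right, Nat.sub_zero,
        Nat.add_sub_cancel]
  rcases Nat.eq_zero_or_pos κ with rfl | hκ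
  · rfl
  · exact h (κ - 1) κ (by omega)

theorem uplusOmega_eq : uplusOmega K q p Q n κ t_ b =
    ((List.range (κ - 1)).map (uFactor (Lm K q p Q n) p (fun k => Qat K Q (k + 1) ^ p)
      (fun j => bsum κ b (j + 1)) (fun j => tsum κ t_ (j + 1)))).prod :=
  rfl

theorem Qat_ne_zero (hQ : ∀ i, Q i ≠ 0) {k : ℕ} (hk : k < t) : Qat K Q (k + 1) ≠ 0 := by
  rw [Qat, dif_pos ⟨by omega, by omega⟩]
  exact hQ _

theorem exists_unit_vb_mul_Tg_zero (hq : q ≠ 0) (hT0 : IsUnit (Tg K q p Q n 0)) (hn : 0 < n)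
    (ht : tsum κ t_ κ = t) (hb : IsComp n κ b) :
    ∃ u : (AK K q p Q n)ˣ, vb K q p Q n κ t_ b * Tg K q p Q n 0 = u * vb K q p Q n κ t_ b := by
  have h : HeckeGens q n (Tg K q p Q n) (Lm K q p Q n) := heckeGens_AK hq
  have hκ : 0 < κ := by
    rcases Nat.eq_zero_or_pos κ with rfl | hκ
    · simp [IsComp, bsum] at hb
      omega
    · exact hκ
  have hb' : bsum κ b (κ - 1 + 1) = n := by rwa [Nat.sub_add_cancel hκ]
  obtain ⟨g, -, e⟩ := h.exists_genUnits_vProd hT0 hn p (fun k => Qat K Q (k + 1) ^ p)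
    (β := fun j => bat κ b (j + 2)) (B := fun j => bsum κ b (j + 1))
    (τ := fun j => tsum κ t_ (j + 1)) (m := κ - 1) (fun j _ => bsum_succ (j + 1)) hb'.le
    (fun i j hij => tsum_mono (by omega))
    (by
      simp only [Nat.sub_add_cancel hκ, ht]
      exact cyclotomic_AK hn) le_rfl
  refine ⟨g, ?_⟩
  rw [vb, vbMinus_eq, uplusOmega_eq, ← e, mul_assoc, mul_assoc]
  congr 1
  refine (Commute.list_prod_right _ _ fun x hx => ?_).eq.symm
  obtain ⟨j, hj, rfl⟩ := List.mem_map.1 hx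
  have := List.mem_range.1 hj
  refine h.commute_gen_levelProdUpTo p _ _ hn ?_ (Or.inr rfl)
  rw [← hb']
  exact Finset.sum_le_sum_of_subset (Finset.Icc_subset_Icc_right (by omega))

theorem exists_isCrossed_AK (hp : 0 < p) (hn : 1 < n) {ε : K} (hε : ε ^ p = 1) (hq : q ≠ 0)
    (hQ : ∀ i, Q i ≠ 0) :
    ∃ (σ : AK K q p Q n →ₐ[K] AK K q p Q n) (u : (AK K q p Q n)ˣ), (u : AK K q p Q n) =
      Tg K q p Q n 0 ∧ IsCrossed p ε σ (AKp K q p Q n) u ∧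
      (∀ i, 1 ≤ i → σ (Tg K q p Q n i) = Tg K q p Q n i) ∧
      ∀ m, σ (Lm K q p Q n (m + 1) ^ p) = Lm K q p Q n (m + 1) ^ p := by
  have h : HeckeGens q n (Tg K q p Q n) (Lm K q p Q n) := heckeGens_AK hq
  obtain ⟨σ, h0, h1, hL⟩ := exists_sigma_AK (Q := Q) (p := p) (n := n) hq hε (by omega)
  obtain ⟨u, hu, hup⟩ := exists_unit_of_list_prod_eq_zero hp (Tg K q p Q n 0)
    ((List.range t).map fun k => Qat K Q (k + 1) ^ p)
    (by
      intro c hc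
      obtain ⟨k, hk, rfl⟩ := List.mem_map.1 hc
      exact pow_ne_zero _ (Qat_ne_zero hQ (List.mem_range.1 hk)))
    (by
      rw [List.map_map]
      exact cyclotomic_AK (by omega))
  refine ⟨σ, u, hu, ?_, h1, fun m => by rw [map_pow, hL, smul_pow, hε, one_smul]⟩
  have := h.isCrossed hn hp hε h0 (fun i hi _ => h1 i hi) hu adjoin_Tg hup
  rwa [← Ring.inverse_unit, hu] at this

end presentation

end HuMathas

open HuMathas in
/-- **Statement 13** (Corollary `dim`).  For every `b ∈ Λ(n,κ)`:
`(1/p)·dim_K End_{H_{r,p,n}}(v_b H_{r,n}) = dim_K End_{H_{r,n}}(v_b H_{r,n})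
  = p·dim_K End_{H_{r,p,n}}(v_b H_{r,p,n})`. -/
theorem end_dim
    (K : Type) [Field K] [IsAlgClosed K]
    (p t n κ : ℕ) (hp : 1 < p) (hn : 3 ≤ n) (ht : 0 < t)
    (ε q : K) (hε : IsPrimitiveRoot ε p) (hq : q ≠ 0)
    (Q : Fin t → K) (hQ : ∀ i, Q i ≠ 0)
    (t_ : Fin κ → ℕ) (horb : OrbitPartition ε q Q κ t_)
    (b : Fin κ → ℕ) (hb : IsComp n κ b) :
    Module.finrank K
        ↥(EndSpace K q p Q n (vSubmodule K q p Q n (vb K q p Q n κ t_ b))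
            (fun h => h ∈ AKp K q p Q n)) =
      p * Module.finrank K
        ↥(EndSpace K q p Q n (vSubmodule K q p Q n (vb K q p Q n κ t_ b))
            (fun _ => True)) ∧
    Module.finrank K
        ↥(EndSpace K q p Q n (vSubmodule K q p Q n (vb K q p Q n κ t_ b))
            (fun _ => True)) =
      p * Module.finrank K
        ↥(EndSpace K q p Q n (vSubmoduleP K q p Q n (vb K q p Q n κ t_ b))
            (fun h => h ∈ AKp K q p Q n)) := by
  have hp0 : 0 < p := by omega
  obtain ⟨σ, u, hu, hc, hσT, hσL⟩ :=
    exists_isCrossed_AK (n := n) hp0 (by omega) hε.pow_eq_one hq hQ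
  have hσv : σ (vb K q p Q n κ t_ b) = vb K q p Q n κ t_ b := by
    rw [vb, vbMinus_eq, uplusOmega_eq, map_mul, map_vProd_of_fixed hσT hσL,
      map_prod_uFactor_of_fixed hσL]
  obtain ⟨w, hw⟩ := exists_unit_vb_mul_Tg_zero (q := q) (p := p) (Q := Q) (t_ := t_) hq
    (hu ▸ u.isUnit) (by omega) horb.1 hb
  rw [← hu] at hw
  set v := vb K q p Q n κ t_ b
  have hvB : v ∈ AKp K q p Q n := (hc.mem_iff hp0 hε).2 hσv
  constructor
  · refine hc.finrank_end_restrict hp0 hε _ ?_ ?_ _ _ (fun _ => Iff.rfl) (fun _ => Iff.rfl)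
    · rintro _ ⟨x, rfl⟩ a
      exact ⟨x * a, (mul_assoc v x a).symm⟩
    · rintro _ ⟨x, rfl⟩
      exact ⟨σ x, by
        show v * σ x = σ (v * x)
        rw [map_mul, hσv]⟩
  · rw [finrank_eq_finrank_endImages ⊤ v _ (fun x => ⟨?_, ?_⟩) _ (fun f => ⟨?_, ?_⟩),
      finrank_eq_finrank_endImages (AKp K q p Q n) v _ (fun x => ⟨?_, ?_⟩) _ (fun _ => Iff.rfl),
      hc.finrank_endImages_top hp0 hε hvB hw]
    · rintro ⟨s, hs, rfl⟩
      exact ⟨s, hs, rfl⟩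
    · rintro ⟨s, hs, rfl⟩
      exact ⟨s, hs, rfl⟩
    · rintro ⟨s, rfl⟩
      exact ⟨s, Algebra.mem_top, rfl⟩
    · rintro ⟨s, -, rfl⟩
      exact ⟨s, rfl⟩
    · intro hf x y s _
      exact hf x y s trivial
    · intro hf x y s _
      exact hf x y s Algebra.mem_top
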